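/- Let A be a closed set of the form A = ⋃_{j=1}^{N} {x ∈ Ω : g_{j,1}(x) ≥ 0, …, g_{j,m_j}(x) ≥ 0}, where Ω ⊆ ℝ^n is an open ball centered at the origin 0 and each g_{j,i} : Ω → ℝ is real-analytic on Ω (every closed semianalytic germ has this form). Assume 0 ∈ A and 0 is not an isolated point of A. Then for every real s ≥ 1 there exist finitely many real polynomials q_{j,i} ∈ ℝ[x_1,…,x_n] such that, setting S = ⋃_{j=1}^{M} {x ∈ ℝ^n : q_{j,1}(x) ≥ 0, …, q_{j,k_j}(x) ≥ 0} (a closed semialgebraic set), one has 0 ∈ S, the intersections A ∩ S_r and S ∩ S_r are nonempty for all sufficiently small r > 0, and lim_{r→0⁺} D(A ∩ S_r, S ∩ S_r)/r^s = 0, where S_r denotes the sphere in ℝ^n of radius r centered at 0 and D denotes the Hausdorff distance between nonempty compact sets. -/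

import Mathlib

open Metric Filter Set

open scoped Topology BoundedContinuousFunction

noncomputable section

/-! ### Shift operators -/

/-- A pair of bounded operators behaving like the left and the right shift on sequences,
with `c` the zeroth coordinate and `e` the sequence `(1, 0, 0, …)`. -/
structure ShiftPair (V : Type*) [NormedAddCommGroup V] [NormedSpace ℝ V] where
  /-- The left shift. -/
  left : V →L[ℝ] V
  /-- The right shift. -/
  right : V →L[ℝ] V
  /-- The zeroth coordinate. -/
  coord : V →L[ℝ] ℝ
  /-- The vector generating the kernel of the left shift. -/
  vec : V
  norm_left_le : ‖left‖ ≤ 1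
  left_mul_right : left * right = 1
  coord_right : ∀ v, coord (right v) = 0
  right_left : ∀ v, right (left v) + coord v • vec = v
  coord_vec : coord vec = 1

/-- The shift operators on bounded real sequences. -/
def boundedShiftPair : ShiftPair (ℕ →ᵇ ℝ) where
  left := LinearMap.mkContinuous
    { toFun := fun v => BoundedContinuousFunction.ofNormedAddCommGroupDiscrete
        (fun k => v (k + 1)) ‖v‖ (fun k => v.norm_coe_le_norm (k + 1))
      map_add' := fun v w => by ext k; simp
      map_smul' := fun c v => by ext k; simp } 1 (fun v => by
    rw [one_mul]
    exact BoundedContinuousFunction.norm_ofNormedAddCommGroup_le _ (norm_nonneg v)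
      (fun k => v.norm_coe_le_norm (k + 1)))
  right := LinearMap.mkContinuous
    { toFun := fun v => BoundedContinuousFunction.ofNormedAddCommGroupDiscrete
        (fun k => if k = 0 then 0 else v (k - 1)) ‖v‖ (fun k => by
          split_ifs
          · simp
          · exact v.norm_coe_le_norm (k - 1))
      map_add' := fun v w => by ext k; by_cases hk : k = 0 <;> simp [hk]
      map_smul' := fun c v => by ext k; by_cases hk : k = 0 <;> simp [hk] } 1 (fun v => by
    rw [one_mul]
    refine BoundedContinuousFunction.norm_ofNormedAddCommGroup_le _ (norm_nonneg v) (fun k => ?_)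
    split_ifs
    · simp
    · exact v.norm_coe_le_norm (k - 1))
  coord := BoundedContinuousFunction.evalCLM ℝ 0
  vec := BoundedContinuousFunction.ofNormedAddCommGroupDiscrete
    (fun k => if k = 0 then 1 else 0) 1 (fun k => by split_ifs <;> simp)
  norm_left_le := LinearMap.mkContinuous_norm_le _ zero_le_one _
  left_mul_right := by ext v k; simp
  coord_right v := by simp
  right_left v := by ext k; by_cases hk : k = 0 <;> simp [hk, Nat.sub_one_add_one]
  coord_vec := by simp

namespace ShiftPair

variable {V : Type*} [NormedAddCommGroup V] [NormedSpace ℝ V] (σ : ShiftPair V)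

lemma left_right (v : V) : σ.left (σ.right v) = v :=
  congrArg (fun T : V →L[ℝ] V => T v) σ.left_mul_right

lemma left_pow_mul_right_pow (d : ℕ) : σ.left ^ d * σ.right ^ d = 1 := by
  induction d with
  | zero => simp
  | succ d ih =>
    rw [pow_succ, pow_succ', mul_assoc, ← mul_assoc σ.left σ.right,
      σ.left_mul_right, one_mul, ih]

lemma left_vec : σ.left σ.vec = 0 := by
  have h1 := σ.right_left σ.vec
  rw [σ.coord_vec, one_smul, add_eq_right] at h1
  rw [← σ.left_right (σ.left σ.vec), h1, map_zero]

variable [CompleteSpace V]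

/-- The functional `v ↦ ∑ k, c (L ^ k v) * s ^ k`, for `s` near `0`, where `L` is the left
shift and `c` the zeroth coordinate. -/
def seriesEval (s : ℝ) : V →L[ℝ] ℝ :=
  σ.coord.comp (Ring.inverse (1 - s • σ.left))

lemma analyticAt_seriesEval : AnalyticAt ℝ σ.seriesEval 0 := by
  have h1 : AnalyticAt ℝ (fun s : ℝ => (1 : V →L[ℝ] V) - s • σ.left) 0 := by
    fun_prop
  have h2 : AnalyticAt ℝ (fun s : ℝ =>
      Ring.inverse ((1 : V →L[ℝ] V) - s • σ.left)) 0 := by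
    refine AnalyticAt.fun_comp (g := Ring.inverse) ?_ h1
    simpa using analyticAt_inverse (A := V →L[ℝ] V) (𝕜 := ℝ) 1
  exact ((ContinuousLinearMap.compL ℝ V V ℝ σ.coord).analyticAt _).fun_comp h2

lemma isUnit_one_sub_smul_left {s : ℝ} (hs : |s| < 1) :
    IsUnit ((1 : V →L[ℝ] V) - s • σ.left) := by
  refine isUnit_one_sub_of_norm_lt_one ?_
  calc ‖s • σ.left‖ ≤ |s| * 1 := by
        rw [norm_smul, Real.norm_eq_abs]; gcongr; exact σ.norm_left_le
    _ < 1 := by simpa using hs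

lemma seriesEval_eq {s : ℝ} (hs : |s| < 1) (v : V) :
    σ.seriesEval s v = σ.coord v + s * σ.seriesEval s (σ.left v) := by
  have h := Ring.inverse_mul_cancel _ (σ.isUnit_one_sub_smul_left hs)
  have h' := congrArg (fun T : V →L[ℝ] V => σ.coord (T v)) h
  simp only [mul_sub, mul_one, mul_smul_comm] at h'
  simp only [sub_apply, smul_apply,
    mul_apply_eq_comp, map_sub, map_smul, smul_eq_mul,
    one_apply_eq_self] at h'
  simp only [seriesEval, ContinuousLinearMap.comp_apply]
  linarith

lemma seriesEval_comp_right {s : ℝ} (hs : |s| < 1) :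
    (σ.seriesEval s).comp σ.right = s • σ.seriesEval s := by
  ext v
  have h := σ.seriesEval_eq hs (σ.right v)
  rw [σ.left_right, σ.coord_right] at h
  simpa using h

lemma seriesEval_vec {s : ℝ} (hs : |s| < 1) : σ.seriesEval s σ.vec = 1 := by
  rw [σ.seriesEval_eq hs, σ.left_vec]
  simp [σ.coord_vec]

lemma seriesEval_eq_sum {s : ℝ} (hs : |s| < 1) (d : ℕ) (v : V) :
    σ.seriesEval s v = ∑ j ∈ Finset.range d, s ^ j * σ.coord ((σ.left ^ j) v)
      + s ^ d * σ.seriesEval s ((σ.left ^ d) v) := by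
  induction d with
  | zero => simp
  | succ d ih =>
    rw [ih, Finset.sum_range_succ, σ.seriesEval_eq hs ((σ.left ^ d) v), pow_succ' σ.left d,
      mul_apply_eq_comp]
    ring

end ShiftPair

/-! ### Evaluating power series on tuples in a Banach algebra -/

section Expansion

variable {X : Type*} [NormedAddCommGroup X] [NormedSpace ℝ X] {ι : Type*} [Fintype ι]

lemma ContinuousMultilinearMap.apply_const_eq_sum_basis (b : Module.Basis ι ℝ X) {n : ℕ}
    (p : ContinuousMultilinearMap ℝ (fun _ : Fin n => X) ℝ) (x : X) :
    p (fun _ => x) = ∑ i : Fin n → ι, (∏ j, b.repr x (i j)) * p (fun j => b (i j)) := by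
  classical
  have h : (fun _ : Fin n => x) = fun _ : Fin n => ∑ a, b.repr x a • b a := by
    funext j; exact (b.sum_repr x).symm
  rw [h, ContinuousMultilinearMap.map_sum]
  refine Finset.sum_congr rfl fun i _ => ?_
  rw [ContinuousMultilinearMap.map_smul_univ, smul_eq_mul]

variable (B : Type*) [NormedRing B] [NormedAlgebra ℝ B]

/-- The power series `p`, expanded in the coordinates of the basis `b`, as a power series
in tuples of elements of a Banach algebra. -/
def FormalMultilinearSeries.inAlgebra (p : FormalMultilinearSeries ℝ X ℝ)
    (b : Module.Basis ι ℝ X) : FormalMultilinearSeries ℝ (ι → B) B :=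
  fun n => ∑ i : Fin n → ι, p n (fun j => b (i j)) •
    (ContinuousMultilinearMap.mkPiAlgebraFin ℝ n B).compContinuousLinearMap
      (fun j => ContinuousLinearMap.proj (i j))

variable {B}

lemma FormalMultilinearSeries.inAlgebra_apply (p : FormalMultilinearSeries ℝ X ℝ)
    (b : Module.Basis ι ℝ X) (n : ℕ) (β : ι → B) :
    p.inAlgebra B b n (fun _ => β) =
      ∑ i : Fin n → ι, p n (fun j => b (i j)) • (List.ofFn fun j => β (i j)).prod := by
  simp [FormalMultilinearSeries.inAlgebra]

lemma FormalMultilinearSeries.inAlgebra_radius_pos (p : FormalMultilinearSeries ℝ X ℝ)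
    (b : Module.Basis ι ℝ X) (hp : 0 < p.radius) : 0 < (p.inAlgebra B b).radius := by
  obtain ⟨C, r, hC, hr, h⟩ := p.le_mul_pow_of_radius_pos hp
  obtain ⟨κ, hκ0, hκ⟩ : ∃ κ : ℝ, 0 < κ ∧ ∀ a, ‖b a‖ ≤ κ :=
    ⟨∑ a, ‖b a‖ + 1, by positivity, fun a => by
      have := Finset.single_le_sum (f := fun a => ‖b a‖) (fun a _ => norm_nonneg _)
        (Finset.mem_univ a)
      linarith⟩
  set D : ℝ := max 1 ‖(1 : B)‖
  have key : ∀ n, ‖p.inAlgebra B b n‖ ≤ (C * D) * ((Fintype.card ι + 1) * (r * κ)) ^ n := by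
    intro n
    have hprod : ∀ (i : Fin n → ι) (m : Fin n → ι → B),
        ‖(List.ofFn fun j => m j (i j)).prod‖ ≤ D * ∏ j, ‖m j‖ := by
      intro i m
      calc ‖(List.ofFn fun j => m j (i j)).prod‖
          ≤ ‖ContinuousMultilinearMap.mkPiAlgebraFin ℝ n B‖ * ∏ j, ‖m j (i j)‖ :=
            (ContinuousMultilinearMap.mkPiAlgebraFin ℝ n B).le_opNorm fun j => m j (i j)
        _ ≤ D * ∏ j, ‖m j‖ := by
            gcongr with j
            · exact ContinuousMultilinearMap.norm_mkPiAlgebraFin_le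
            · exact norm_le_pi_norm _ _
    have hcoef : ∀ i : Fin n → ι, ‖p n (fun j => b (i j))‖ ≤ C * r ^ n * κ ^ n := fun i =>
      calc ‖p n (fun j => b (i j))‖ ≤ ‖p n‖ * ∏ j, ‖b (i j)‖ := (p n).le_opNorm _
        _ ≤ (C * r ^ n) * ∏ j : Fin n, κ := by
            gcongr with j
            · exact h n
            · exact hκ _
        _ = C * r ^ n * κ ^ n := by simp
    refine ContinuousMultilinearMap.opNorm_le_bound (by positivity) fun m => ?_
    calc ‖p.inAlgebra B b n m‖
        = ‖∑ i : Fin n → ι, p n (fun j => b (i j)) • (List.ofFn fun j => m j (i j)).prod‖ := by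
          simp [FormalMultilinearSeries.inAlgebra]
      _ ≤ ∑ i : Fin n → ι, (C * r ^ n * κ ^ n) * (D * ∏ j, ‖m j‖) := by
          refine (norm_sum_le _ _).trans (Finset.sum_le_sum fun i _ => ?_)
          rw [norm_smul]
          gcongr
          · exact hcoef i
          · exact hprod i m
      _ = (C * D) * (Fintype.card ι * (r * κ)) ^ n * ∏ j, ‖m j‖ := by
          simp [mul_pow]; ring
      _ ≤ _ := by gcongr; linarith
  set q : ℝ := (Fintype.card ι + 1) * (r * κ)
  have hq : 0 < q := by positivity
  have : ((q⁻¹).toNNReal : ENNReal) ≤ (p.inAlgebra B b).radius := by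
    refine FormalMultilinearSeries.le_radius_of_bound _ (C * D) fun n => ?_
    rw [Real.coe_toNNReal _ (inv_nonneg.2 hq.le)]
    calc _ ≤ (C * D) * q ^ n * q⁻¹ ^ n := by gcongr; exact key n
      _ = C * D := by rw [mul_assoc, ← mul_pow, mul_inv_cancel₀ hq.ne', one_pow, mul_one]
  refine lt_of_lt_of_le ?_ this
  simpa using hq

end Expansion

section Division

variable {X : Type*} [NormedAddCommGroup X] [NormedSpace ℝ X] {ι : Type*} [Fintype ι]
  {V : Type*} [NormedAddCommGroup V] [NormedSpace ℝ V]

lemma ContinuousLinearMap.comp_prod_ofFn_of_comp_eq_smul (χ : V →L[ℝ] ℝ) {n : ℕ}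
    (T : Fin n → V →L[ℝ] V) (c : Fin n → ℝ) (h : ∀ j, χ.comp (T j) = c j • χ) :
    χ.comp (List.ofFn T).prod = (∏ j, c j) • χ := by
  induction n with
  | zero => ext v; simp
  | succ n ih =>
    have h1 := ih (fun j => T j.succ) (fun j => c j.succ) (fun j => h j.succ)
    rw [List.ofFn_succ, List.prod_cons, Fin.prod_univ_succ]
    have h2 : χ.comp (T 0 * (List.ofFn fun j : Fin n => T j.succ).prod)
        = (χ.comp (T 0)).comp (List.ofFn fun j : Fin n => T j.succ).prod := rfl
    rw [h2, h 0, ContinuousLinearMap.smul_comp, h1, smul_smul]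

lemma List.prod_ofFn_smul {B : Type*} [Ring B] [Algebra ℝ B] (S : B) {n : ℕ} (c : Fin n → ℝ) :
    (List.ofFn fun j => c j • S).prod = (∏ j, c j) • S ^ n := by
  induction n with
  | zero => simp
  | succ n ih =>
    rw [List.ofFn_succ, List.prod_cons, Fin.prod_univ_succ, ih, smul_mul_smul_comm, pow_succ']

variable [FiniteDimensional ℝ X]

/-- The tuple of operators representing the coordinates of `z + ρ s v`, where multiplication by
the variable `s` is represented by the right shift. -/
def ShiftPair.coordOperators (σ : ShiftPair V) (b : Module.Basis ι ℝ X) (v : X) :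
    X × ℝ →L[ℝ] (ι → V →L[ℝ] V) :=
  LinearMap.toContinuousLinearMap
    { toFun := fun w a => b.repr w.1 a • 1 + (w.2 * b.repr v a) • σ.right
      map_add' := fun w w' => by
        funext a; simp only [Prod.fst_add, Prod.snd_add, map_add, Finsupp.add_apply, Pi.add_apply]
        module
      map_smul' := fun c w => by
        funext a
        simp only [Prod.smul_fst, Prod.smul_snd, map_smul, Finsupp.smul_apply, smul_eq_mul,
          RingHom.id_apply, Pi.smul_apply]
        module }

lemma ShiftPair.coordOperators_apply {κ : Type*} (σ : ShiftPair V) (b : Module.Basis κ ℝ X)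
    (v z : X) (ρ : ℝ) (a : κ) :
    σ.coordOperators b v (z, ρ) a = b.repr z a • 1 + (ρ * b.repr v a) • σ.right := rfl

variable [CompleteSpace V]

lemma ShiftPair.exists_operator_family (σ : ShiftPair V) (v : X) {g : X → ℝ}
    {p : FormalMultilinearSeries ℝ X ℝ} (hp : HasFPowerSeriesAt g p 0) :
    ∃ G : ℝ → X → (V →L[ℝ] V), (∀ᶠ ρ in 𝓝 (0 : ℝ), AnalyticAt ℝ (G ρ) 0) ∧
      (∀ᶠ ρ in 𝓝 (0 : ℝ), ∀ᶠ z in 𝓝 (0 : X), ∀ s : ℝ, |s| < 1 →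
        (σ.seriesEval s).comp (G ρ z) = g (z + (ρ * s) • v) • σ.seriesEval s) ∧
      ∀ N : ℕ, (fun ρ => G ρ 0 - ∑ n ∈ Finset.range N, (ρ ^ n * p n (fun _ => v)) • σ.right ^ n)
        =O[𝓝 0] fun ρ => ρ ^ N := by
  obtain ⟨r, hr⟩ := hp
  let b := Module.finBasis ℝ X
  let P := p.inAlgebra (V →L[ℝ] V) b
  have hP : 0 < P.radius := p.inAlgebra_radius_pos b hr.radius_pos
  have hPs : HasFPowerSeriesOnBall P.sum P 0 P.radius := P.hasFPowerSeriesOnBall hP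
  let Ψ := σ.coordOperators b v
  have hΨ0 : Ψ (0, 0) = 0 := map_zero Ψ
  have hball : ∀ᶠ w : X × ℝ in 𝓝 (0, 0), Ψ w ∈ Metric.eball 0 P.radius := by
    have : Tendsto Ψ (𝓝 (0, 0)) (𝓝 0) := hΨ0 ▸ Ψ.continuous.tendsto _
    exact this (Metric.eball_mem_nhds _ hP)
  refine ⟨fun ρ z => P.sum (Ψ (z, ρ)), ?_, ?_, ?_⟩
  · have h1 : Tendsto (fun ρ : ℝ => ((0 : X), ρ)) (𝓝 0) (𝓝 (0, 0)) :=
      (Continuous.prodMk_right (0 : X)).tendsto 0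
    filter_upwards [h1.eventually hball] with ρ hρ
    refine AnalyticAt.fun_comp (g := P.sum) (hPs.analyticAt_of_mem hρ) ?_
    exact (Ψ.analyticAt _).fun_comp (analyticAt_id.prod analyticAt_const)
  · have h1 : ∀ᶠ w : X × ℝ in 𝓝 (0, 0), ∀ s : ℝ, |s| < 1 →
        (σ.seriesEval s).comp (P.sum (Ψ w)) = g (w.1 + (w.2 * s) • v) • σ.seriesEval s := by
      have hx : ∀ᶠ w : X × ℝ in 𝓝 (0, 0), ∀ s : ℝ, |s| < 1 →
          w.1 + (w.2 * s) • v ∈ Metric.eball (0 : X) r := by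
        have hnt : Tendsto (fun w : X × ℝ => ‖w.1‖ + |w.2| * ‖v‖) (𝓝 (0, 0)) (𝓝 0) := by
          have : Continuous (fun w : X × ℝ => ‖w.1‖ + |w.2| * ‖v‖) := by fun_prop
          simpa using this.tendsto (0, 0)
        obtain ⟨ε, hε, hεr⟩ := Metric.mem_nhds_iff.1 (Metric.eball_mem_nhds (0 : X) hr.r_pos)
        filter_upwards [hnt.eventually (gt_mem_nhds hε)] with w hw s hs
        apply hεr
        rw [mem_ball_zero_iff]
        calc ‖w.1 + (w.2 * s) • v‖ ≤ ‖w.1‖ + |w.2| * |s| * ‖v‖ := by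
              refine (norm_add_le _ _).trans ?_
              rw [norm_smul, Real.norm_eq_abs, abs_mul]
          _ ≤ ‖w.1‖ + |w.2| * 1 * ‖v‖ := by gcongr
          _ < ε := by simpa using hw
      filter_upwards [hball, hx] with w hw hwx s hs
      have hχ : ∀ a, (σ.seriesEval s).comp (Ψ w a)
          = b.repr (w.1 + (w.2 * s) • v) a • σ.seriesEval s := by
        intro a
        rw [show Ψ w a = b.repr w.1 a • 1 + (w.2 * b.repr v a) • σ.right from rfl,
          ContinuousLinearMap.comp_add, ContinuousLinearMap.comp_smul,
          ContinuousLinearMap.comp_smul, σ.seriesEval_comp_right hs]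
        simp only [map_add, map_smul, Finsupp.add_apply, Finsupp.smul_apply, smul_eq_mul]
        rw [show (σ.seriesEval s).comp (1 : V →L[ℝ] V) = σ.seriesEval s from
          ContinuousLinearMap.comp_id _]
        module
      have hterm : ∀ n, (σ.seriesEval s).comp (P n (fun _ => Ψ w))
          = p n (fun _ => w.1 + (w.2 * s) • v) • σ.seriesEval s := by
        intro n
        rw [p.inAlgebra_apply b n, (p n).apply_const_eq_sum_basis b, Finset.sum_smul,
          ContinuousLinearMap.comp_finsetSum]
        refine Finset.sum_congr rfl fun i _ => ?_
        rw [ContinuousLinearMap.comp_smul,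
          ContinuousLinearMap.comp_prod_ofFn_of_comp_eq_smul _ _ _ (fun j => hχ (i j)),
          smul_smul, mul_comm]
      have hs1 : HasSum (fun n => (σ.seriesEval s).comp (P n (fun _ => Ψ w)))
          ((σ.seriesEval s).comp (P.sum (Ψ w))) :=
        (P.hasSum hw).mapL (ContinuousLinearMap.compL ℝ V V ℝ (σ.seriesEval s))
      have hs2 : HasSum (fun n => p n (fun _ => w.1 + (w.2 * s) • v) • σ.seriesEval s)
          (g (w.1 + (w.2 * s) • v) • σ.seriesEval s) := by
        have := hr.hasSum (hwx s hs)
        rw [zero_add] at this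
        exact this.smul_const _
      simp_rw [hterm] at hs1
      exact hs1.unique hs2
    rw [nhds_prod_eq] at h1
    have h2 := (eventually_swap_iff.1 h1).curry
    exact h2
  · intro N
    have hO := (HasFPowerSeriesOnBall.hasFPowerSeriesAt hPs).isBigO_sub_partialSum_pow N
    have h1 : Tendsto (fun ρ : ℝ => Ψ (0, ρ)) (𝓝 0) (𝓝 0) := by
      have : Continuous fun ρ : ℝ => Ψ (0, ρ) := by fun_prop
      simpa [hΨ0] using this.tendsto 0
    have h2 := hO.comp_tendsto h1
    have hpart : ∀ ρ : ℝ, P.partialSum N (Ψ (0, ρ))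
        = ∑ n ∈ Finset.range N, (ρ ^ n * p n (fun _ => v)) • σ.right ^ n := by
      intro ρ
      refine Finset.sum_congr rfl fun n _ => ?_
      rw [p.inAlgebra_apply b n, (p n).apply_const_eq_sum_basis b, Finset.mul_sum,
        Finset.sum_smul]
      refine Finset.sum_congr rfl fun i _ => ?_
      have : (fun j => Ψ (0, ρ) (i j)) = fun j => (ρ * b.repr v (i j)) • σ.right := by
        funext j
        simp [Ψ, σ.coordOperators_apply]
      rw [this, List.prod_ofFn_smul, smul_smul, Finset.prod_mul_distrib]
      congr 1
      simp; ring
    simp only [Function.comp_def, zero_add, hpart] at h2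
    refine h2.trans (Asymptotics.IsBigO.pow ?_ N)
    refine Asymptotics.IsBigO.norm_left ?_
    have h3 : (fun ρ : ℝ => Ψ (0, ρ)) = fun ρ : ℝ => ρ • Ψ (0, 1) := by
      funext ρ; rw [← map_smul]; simp
    rw [h3]
    refine Asymptotics.IsBigO.of_bound ‖Ψ (0, 1)‖ (Eventually.of_forall fun ρ => ?_)
    rw [norm_smul, mul_comm]

end Division

section WeierstrassDivision

variable {X : Type*} [NormedAddCommGroup X] [NormedSpace ℝ X]
  {V : Type*} [NormedAddCommGroup V] [NormedSpace ℝ V]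

lemma analyticAt_clm_apply {W : Type*} [NormedAddCommGroup W] [NormedSpace ℝ W]
    {T : X → V →L[ℝ] W} {u : X → V} {x : X} (hT : AnalyticAt ℝ T x) (hu : AnalyticAt ℝ u x) :
    AnalyticAt ℝ (fun y => T y (u y)) x :=
  ((ContinuousLinearMap.id ℝ (V →L[ℝ] W)).analyticAt_bilinear (T x, u x)).fun_comp
    (f := fun y => (T y, u y)) (hT.prod hu)

lemma ShiftPair.sum_smul_right_pow (σ : ShiftPair V) {c : ℕ → ℝ} {d : ℕ}
    (hlow : ∀ n < d, c n = 0) (ρ : ℝ) :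
    σ.left ^ d * ∑ n ∈ Finset.range (d + 1), (ρ ^ n * c n) • σ.right ^ n = (ρ ^ d * c d) • 1 := by
  rw [Finset.sum_range_succ, Finset.sum_eq_zero, zero_add, mul_smul_comm,
    σ.left_pow_mul_right_pow]
  intro n hn
  rw [hlow n (Finset.mem_range.1 hn), mul_zero, zero_smul]

variable [FiniteDimensional ℝ X] [CompleteSpace V]

lemma ShiftPair.eventually_isUnit (σ : ShiftPair V) {T : ℝ → V →L[ℝ] V} {c : ℕ → ℝ} {d : ℕ}
    (hlow : ∀ n < d, c n = 0) (hd : c d ≠ 0)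
    (hT : (fun ρ => T ρ - ∑ n ∈ Finset.range (d + 1), (ρ ^ n * c n) • σ.right ^ n)
        =O[𝓝 0] fun ρ => ρ ^ (d + 1)) :
    ∀ᶠ ρ in 𝓝[≠] (0 : ℝ), IsUnit (σ.left ^ d * T ρ) := by
  have h1 : (fun ρ => σ.left ^ d * T ρ - (ρ ^ d * c d) • 1) =o[𝓝 0] fun ρ : ℝ => ρ ^ d := by
    have h2 : (fun ρ => σ.left ^ d * T ρ - (ρ ^ d * c d) • 1) =O[𝓝 0]
        fun ρ : ℝ => ρ ^ (d + 1) := by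
      refine Asymptotics.IsBigO.trans (Asymptotics.IsBigO.of_bound ‖σ.left ^ d‖ ?_) hT
      refine Eventually.of_forall fun ρ => ?_
      rw [← σ.sum_smul_right_pow hlow ρ, ← mul_sub]
      exact norm_mul_le _ _
    exact h2.trans_isLittleO (Asymptotics.isLittleO_pow_pow (Nat.lt_succ_self d))
  have h3 := h1.def (c := |c d| / 2) (by positivity)
  rw [eventually_nhdsWithin_iff]
  filter_upwards [h3] with ρ hρ hne
  have hne' : ρ ≠ 0 := hne
  have ha : ρ ^ d * c d ≠ 0 := mul_ne_zero (pow_ne_zero _ hne') hd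
  have h4 : IsUnit ((1 : V →L[ℝ] V) - (1 - (ρ ^ d * c d)⁻¹ • (σ.left ^ d * T ρ))) := by
    refine isUnit_one_sub_of_norm_lt_one ?_
    have h5 : (1 : V →L[ℝ] V) - (ρ ^ d * c d)⁻¹ • (σ.left ^ d * T ρ)
        = -((ρ ^ d * c d)⁻¹ • (σ.left ^ d * T ρ - (ρ ^ d * c d) • 1)) := by
      rw [smul_sub, smul_smul, inv_mul_cancel₀ ha, one_smul, neg_sub]
    rw [h5, norm_neg, norm_smul, norm_inv, Real.norm_eq_abs, inv_mul_lt_iff₀ (by positivity),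
      abs_mul]
    refine hρ.trans_lt ?_
    rw [Real.norm_eq_abs]
    have : 0 < |ρ ^ d| * |c d| := by positivity
    linarith
  rw [sub_sub_cancel] at h4
  have h6 : σ.left ^ d * T ρ
      = algebraMap ℝ (V →L[ℝ] V) (ρ ^ d * c d) * ((ρ ^ d * c d)⁻¹ • (σ.left ^ d * T ρ)) := by
    rw [← Algebra.smul_def, smul_smul, mul_inv_cancel₀ ha, one_smul]
  rw [h6]
  exact ((IsUnit.mk0 _ ha).map (algebraMap ℝ (V →L[ℝ] V))).mul h4

theorem ShiftPair.weierstrass_division (σ : ShiftPair V) (ℓ : X →L[ℝ] ℝ) (v : X)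
    {g : X → ℝ} (hg : AnalyticAt ℝ g 0) (hgv : ¬ ∀ᶠ s in 𝓝 (0 : ℝ), g (s • v) = 0) :
    ∃ d : ℕ, ∀ f : X → ℝ, AnalyticAt ℝ f 0 → ∃ (q : X → ℝ) (r : ℕ → X → ℝ),
      AnalyticAt ℝ q 0 ∧ (∀ j, AnalyticAt ℝ (r j) 0) ∧
      ∀ᶠ x in 𝓝 (0 : X), f x = q x * g x
        + ∑ j ∈ Finset.range d, r j (x - ℓ x • v) * ℓ x ^ j := by
  obtain ⟨p, hp⟩ := hg
  have hex : ∃ n, p n (fun _ => v) ≠ 0 := by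
    by_contra! hall
    apply hgv
    have ht : Tendsto (fun s : ℝ => s • v) (𝓝 0) (𝓝 0) := by
      have : Continuous fun s : ℝ => s • v := by fun_prop
      simpa using this.tendsto 0
    filter_upwards [ht.eventually hp.eventually_hasSum] with s hs
    rw [zero_add] at hs
    refine hs.unique ?_
    simp_rw [ContinuousMultilinearMap.map_smul_univ, hall, smul_zero]
    exact hasSum_zero
  classical
  let d := Nat.find hex
  have hlow : ∀ n < d, p n (fun _ => v) = 0 := fun n hn => not_not.1 (Nat.find_min hex hn)
  have hd : p d (fun _ => v) ≠ 0 := Nat.find_spec hex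
  obtain ⟨G, hGa, hGs, hGO⟩ := σ.exists_operator_family v hp
  have hU := σ.eventually_isUnit (c := fun n => p n (fun _ => v)) hlow hd (hGO (d + 1))
  refine ⟨d, fun f ⟨pf, hpf⟩ => ?_⟩
  obtain ⟨F, hFa, hFs, -⟩ := σ.exists_operator_family v hpf
  obtain ⟨ρ, ⟨⟨⟨⟨hUρ, hGaρ⟩, hGsρ⟩, hFaρ⟩, hFsρ⟩, hρ0⟩ :=
    ((((hU.and (hGa.filter_mono nhdsWithin_le_nhds)).and
      (hGs.filter_mono nhdsWithin_le_nhds)).and (hFa.filter_mono nhdsWithin_le_nhds)).and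
      (hFs.filter_mono nhdsWithin_le_nhds) |>.and eventually_mem_nhdsWithin).exists
  have hρ : ρ ≠ 0 := hρ0
  let T : X → V →L[ℝ] V := fun z => σ.left ^ d * G ρ z
  have hTa : AnalyticAt ℝ T 0 := analyticAt_const.mul hGaρ
  have hTinv : AnalyticAt ℝ (fun z => Ring.inverse (T z)) 0 := by
    refine AnalyticAt.fun_comp (g := Ring.inverse) ?_ hTa
    obtain ⟨u, hu⟩ := hUρ
    rw [show T 0 = u from hu.symm]
    exact analyticAt_inverse (𝕜 := ℝ) u
  have hTunit : ∀ᶠ z in 𝓝 (0 : X), IsUnit (T z) :=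
    hTa.continuousAt.eventually (Units.isOpen.mem_nhds hUρ)
  let Q : X → V := fun z => Ring.inverse (T z) ((σ.left ^ d) (F ρ z σ.vec))
  let E : X → V := fun z => F ρ z σ.vec - G ρ z (Q z)
  have hFv : AnalyticAt ℝ (fun z => F ρ z σ.vec) 0 := analyticAt_clm_apply hFaρ analyticAt_const
  have hQ : AnalyticAt ℝ Q 0 :=
    analyticAt_clm_apply hTinv (((σ.left ^ d).analyticAt _).fun_comp hFv)
  have hE : AnalyticAt ℝ E 0 := hFv.sub (analyticAt_clm_apply hGaρ hQ)
  have hEleft : ∀ᶠ z in 𝓝 (0 : X), (σ.left ^ d) (E z) = 0 := by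
    filter_upwards [hTunit] with z hz
    have h1 : T z (Q z) = (σ.left ^ d) (F ρ z σ.vec) := by
      have := Ring.mul_inverse_cancel _ hz
      exact congrArg (fun S : V →L[ℝ] V => S ((σ.left ^ d) (F ρ z σ.vec))) this
    have h2 : T z (Q z) = (σ.left ^ d) (G ρ z (Q z)) := rfl
    simp only [E, map_sub]
    rw [← h1, h2, sub_self]
  let π : X →L[ℝ] X := ContinuousLinearMap.id ℝ X - ℓ.smulRight v
  have hπ : ∀ x, π x = x - ℓ x • v := fun x => rfl
  have hπ0 : Tendsto π (𝓝 0) (𝓝 0) := by simpa using π.continuous.tendsto 0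
  have hℓ0 : Tendsto (fun x => ℓ x / ρ) (𝓝 0) (𝓝 0) := by
    have : Continuous fun x => ℓ x / ρ := by fun_prop
    simpa using this.tendsto 0
  refine ⟨fun x => σ.seriesEval (ℓ x / ρ) (Q (π x)),
    fun j z => (ρ⁻¹) ^ j * σ.coord ((σ.left ^ j) (E z)), ?_, ?_, ?_⟩
  · refine analyticAt_clm_apply ?_ ?_
    · refine AnalyticAt.fun_comp (g := σ.seriesEval) ?_ ?_
      · simpa using σ.analyticAt_seriesEval
      · exact (ℓ.analyticAt 0).div_const
    · refine AnalyticAt.fun_comp (g := Q) ?_ (π.analyticAt 0)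
      simpa using hQ
  · intro j
    exact analyticAt_const.mul ((σ.coord.analyticAt _).fun_comp
      (((σ.left ^ j).analyticAt _).fun_comp hE))
  · have hsmall : ∀ᶠ x in 𝓝 (0 : X), |ℓ x / ρ| < 1 := by
      have := hℓ0.abs
      rw [abs_zero] at this
      exact this.eventually (gt_mem_nhds one_pos)
    filter_upwards [hsmall, hπ0.eventually hEleft, hπ0.eventually hGsρ, hπ0.eventually hFsρ]
      with x hs hEx hGx hFx
    have hx : π x + (ρ * (ℓ x / ρ)) • v = x := by
      rw [mul_div_cancel₀ _ hρ, hπ]; abel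
    have h1 := congrArg (fun S : V →L[ℝ] ℝ => S σ.vec) (hFx _ hs)
    have h2 := congrArg (fun S : V →L[ℝ] ℝ => S (Q (π x))) (hGx _ hs)
    simp only [hx, ContinuousLinearMap.comp_apply, smul_apply, smul_eq_mul,
      σ.seriesEval_vec hs, mul_one] at h1 h2
    have h3 := σ.seriesEval_eq_sum hs d (E (π x))
    rw [hEx, map_zero, mul_zero, add_zero] at h3
    have h4 : σ.seriesEval (ℓ x / ρ) (E (π x))
        = f x - g x * σ.seriesEval (ℓ x / ρ) (Q (π x)) := by
      simp only [E, map_sub, h1, h2]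
    rw [h3] at h4
    rw [← hπ x]
    have h5 : ∑ j ∈ Finset.range d, ((ρ⁻¹) ^ j * σ.coord ((σ.left ^ j) (E (π x)))) * ℓ x ^ j
        = ∑ j ∈ Finset.range d, (ℓ x / ρ) ^ j * σ.coord ((σ.left ^ j) (E (π x))) := by
      refine Finset.sum_congr rfl fun j _ => ?_
      rw [div_eq_mul_inv, mul_pow]; ring
    rw [h5, h4]; ring

end WeierstrassDivision

theorem weierstrass_division {X : Type*} [NormedAddCommGroup X] [NormedSpace ℝ X]
    [FiniteDimensional ℝ X] (ℓ : X →L[ℝ] ℝ) (v : X)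
    {g : X → ℝ} (hg : AnalyticAt ℝ g 0) (hgv : ¬ ∀ᶠ s in 𝓝 (0 : ℝ), g (s • v) = 0) :
    ∃ d : ℕ, ∀ f : X → ℝ, AnalyticAt ℝ f 0 → ∃ (q : X → ℝ) (r : ℕ → X → ℝ),
      AnalyticAt ℝ q 0 ∧ (∀ j, AnalyticAt ℝ (r j) 0) ∧
      ∀ᶠ x in 𝓝 (0 : X), f x = q x * g x
        + ∑ j ∈ Finset.range d, r j (x - ℓ x • v) * ℓ x ^ j :=
  boundedShiftPair.weierstrass_division ℓ v hg hgv

section PseudoDivision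

open Polynomial

variable {A : Type*} [CommRing A] {P : Ideal A[X]}

/-- A polynomial in `P` all of whose relevant coefficients lie in low degree has coefficients in
`P`, provided `P` has no element of low degree with leading coefficient outside `P`. -/
lemma Polynomial.C_coeff_mem_of_natDegree_lt {d : ℕ}
    (hmin : ∀ u ∈ P, C u.leadingCoeff ∉ P → d ≤ u.natDegree) {u : A[X]} (hu : u ∈ P)
    (hd : u.natDegree < d) (i : ℕ) : C (u.coeff i) ∈ P := by
  classical
  by_contra hi
  let t := u.support.filter fun j => C (u.coeff j) ∉ P
  let u' : A[X] := ∑ j ∈ t, monomial j (u.coeff j)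
  have hcoeff : ∀ j, u'.coeff j = if j ∈ t then u.coeff j else 0 := by
    intro j
    simp [u', coeff_monomial]
  have hne : ∀ j, u'.coeff j ≠ 0 → C (u'.coeff j) ∉ P := by
    intro j hj
    rw [hcoeff] at hj ⊢
    split_ifs at hj ⊢ with h
    · exact (Finset.mem_filter.1 h).2
    · exact absurd rfl hj
  have hu' : u' ∈ P := by
    have hsum : u = ∑ j ∈ u.support, monomial j (u.coeff j) := u.as_sum_support
    have h1 : u = u' + ∑ j ∈ u.support with ¬ (C (u.coeff j) ∉ P), monomial j (u.coeff j) := by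
      conv_lhs => rw [hsum]
      exact (Finset.sum_filter_add_sum_filter_not _ _ _).symm
    have h2 : ∑ j ∈ u.support with ¬ (C (u.coeff j) ∉ P), monomial j (u.coeff j) ∈ P := by
      refine Ideal.sum_mem _ fun j hj => ?_
      have := not_not.1 (Finset.mem_filter.1 hj).2
      rw [← C_mul_X_pow_eq_monomial]
      exact P.mul_mem_right _ this
    have h3 : u' = u - ∑ j ∈ u.support with ¬ (C (u.coeff j) ∉ P), monomial j (u.coeff j) :=
      eq_sub_of_add_eq h1.symm
    rw [h3]
    exact P.sub_mem hu h2
  have hi' : i ∈ t := by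
    refine Finset.mem_filter.2 ⟨mem_support_iff.2 fun h => hi ?_, hi⟩
    rw [h, map_zero]; exact P.zero_mem
  have hu0 : u' ≠ 0 := by
    intro h
    have := hcoeff i
    rw [h, if_pos hi', coeff_zero] at this
    exact mem_support_iff.1 (Finset.mem_filter.1 hi').1 this.symm
  have hdeg : u'.natDegree ≤ u.natDegree := by
    refine natDegree_le_iff_coeff_eq_zero.2 fun j hj => ?_
    rw [hcoeff, coeff_eq_zero_of_natDegree_lt hj, ite_self]
  have := hmin u' hu' (hne _ (leadingCoeff_ne_zero.2 hu0))
  omega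

lemma Polynomial.exists_pseudo_division (p : A[X]) (hp : 0 < p.natDegree) (n : ℕ) :
    ∀ r : A[X], r.natDegree < n → ∃ (e : ℕ) (q s : A[X]),
      C p.leadingCoeff ^ e * r = q * p + s ∧ s.natDegree < p.natDegree := by
  induction n with
  | zero => intro r hr; omega
  | succ n ih =>
    intro r hr
    by_cases hlt : r.natDegree < p.natDegree
    · exact ⟨0, 0, r, by simp, hlt⟩
    let k := r.natDegree - p.natDegree
    let r' := C p.leadingCoeff * r - C r.leadingCoeff * X ^ k * p
    have hr' : r'.natDegree ≤ r.natDegree - 1 := by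
      refine natDegree_le_iff_coeff_eq_zero.2 fun j hj => ?_
      have hk : k ≤ j := by omega
      have h1 : (C r.leadingCoeff * X ^ k * p).coeff j = r.leadingCoeff * p.coeff (j - k) := by
        rw [mul_assoc, coeff_C_mul, coeff_X_pow_mul', if_pos hk]
      simp only [r', coeff_sub, coeff_C_mul, h1]
      rcases eq_or_ne j r.natDegree with rfl | hne
      · have : r.natDegree - k = p.natDegree := by omega
        rw [this, coeff_natDegree, coeff_natDegree]; ring
      · rw [coeff_eq_zero_of_natDegree_lt (by omega : r.natDegree < j),
          coeff_eq_zero_of_natDegree_lt (by omega : p.natDegree < j - k)]; ring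
    obtain ⟨e, q, s, h, hs⟩ := ih r' (by omega)
    refine ⟨e + 1, q + C p.leadingCoeff ^ e * C r.leadingCoeff * X ^ k, s, ?_, hs⟩
    have : C p.leadingCoeff * r = r' + C r.leadingCoeff * X ^ k * p := by
      simp [r']
    rw [pow_succ, mul_assoc, this, mul_add, h]; ring

theorem Polynomial.exists_mem_prime_pseudo_divisor (hP : P.IsPrime)
    (hchar : ∀ n : ℕ, n ≠ 0 → (n : A[X]) ∉ P) {w : A[X]} (hw : w ∈ P)
    (hwl : C w.leadingCoeff ∉ P) :
    ∃ p ∈ P, C p.leadingCoeff ∉ P ∧ derivative p ∉ P ∧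
      ∀ r ∈ P, ∃ (e : ℕ) (q s : A[X]), C p.leadingCoeff ^ e * r = q * p + s ∧
        ∀ i, C (s.coeff i) ∈ P := by
  classical
  have hex : ∃ d, ∃ p ∈ P, C p.leadingCoeff ∉ P ∧ p.natDegree = d := ⟨_, w, hw, hwl, rfl⟩
  obtain ⟨p, hp, hpl, hpd⟩ := Nat.find_spec hex
  have hmin : ∀ u ∈ P, C u.leadingCoeff ∉ P → p.natDegree ≤ u.natDegree := by
    intro u hu hul
    rw [hpd]
    exact Nat.find_min' hex ⟨u, hu, hul, rfl⟩
  have hpos : 0 < p.natDegree := by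
    by_contra h0
    apply hpl
    rw [eq_C_of_natDegree_eq_zero (by omega : p.natDegree = 0)] at hp ⊢
    simpa using hp
  refine ⟨p, hp, hpl, ?_, ?_⟩
  · intro hder
    have h1 := C_coeff_mem_of_natDegree_lt hmin hder
      (natDegree_derivative_lt (by omega)) (p.natDegree - 1)
    rw [coeff_derivative, Nat.sub_add_cancel hpos, C_mul] at h1
    rcases hP.mem_or_mem h1 with h | h
    · exact hpl h
    · refine hchar p.natDegree (by omega) ?_
      have : ((p.natDegree - 1 : ℕ) : A) + 1 = (p.natDegree : A) := by
        rw [← Nat.cast_add_one, Nat.sub_add_cancel hpos]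
      rw [this] at h
      simpa using h
  · intro r hr
    obtain ⟨e, q, s, h, hs⟩ := exists_pseudo_division p hpos _ r (Nat.lt_succ_self _)
    refine ⟨e, q, s, h, C_coeff_mem_of_natDegree_lt hmin ?_ hs⟩
    have : s = C p.leadingCoeff ^ e * r - q * p := by rw [h]; ring
    rw [this]
    exact P.sub_mem (P.mul_mem_left _ hr) (P.mul_mem_left _ hp)

end PseudoDivision

section Flat

variable {U : Ultrafilter ℕ} {t : ℕ → ℝ}

/-- The sequence `u` is, along the ultrafilter `U`, smaller than any power of `t`. -/
def IsFlat (U : Ultrafilter ℕ) (t u : ℕ → ℝ) : Prop :=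
  ∀ N : ℕ, ∀ᶠ k in (U : Filter ℕ), |u k| ≤ t k ^ N

lemma eventually_mul_pow_le (ht0 : ∀ᶠ k in (U : Filter ℕ), 0 < t k)
    (ht : Tendsto t U (𝓝 0)) (C : ℝ) {a b : ℕ} (hab : a < b) :
    ∀ᶠ k in (U : Filter ℕ), C * t k ^ b ≤ t k ^ a := by
  have h1 : Tendsto (fun k => |C| * t k) U (𝓝 0) := by simpa using ht.const_mul |C|
  filter_upwards [ht0, ht.eventually (gt_mem_nhds one_pos), h1.eventually (gt_mem_nhds one_pos)]
    with k hk hk1 hkC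
  calc C * t k ^ b ≤ |C| * t k ^ (a + 1) :=
        mul_le_mul (le_abs_self C) (pow_le_pow_of_le_one hk.le hk1.le hab) (by positivity)
          (abs_nonneg C)
    _ = (|C| * t k) * t k ^ a := by ring
    _ ≤ 1 * t k ^ a := by gcongr
    _ = t k ^ a := one_mul _

lemma IsFlat.add (ht0 : ∀ᶠ k in (U : Filter ℕ), 0 < t k) (ht : Tendsto t U (𝓝 0))
    {u v : ℕ → ℝ} (hu : IsFlat U t u) (hv : IsFlat U t v) :
    IsFlat U t (fun k => u k + v k) := by
  intro N
  filter_upwards [hu (N + 1), hv (N + 1), eventually_mul_pow_le ht0 ht 2 (Nat.lt_add_one N)]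
    with k h1 h2 h3
  exact (abs_add_le _ _).trans (by linarith)

lemma IsFlat.mul_left_of_tendsto (ht0 : ∀ᶠ k in (U : Filter ℕ), 0 < t k)
    (ht : Tendsto t U (𝓝 0)) {u v : ℕ → ℝ} {c : ℝ} (hu : Tendsto u U (𝓝 c))
    (hv : IsFlat U t v) : IsFlat U t (fun k => u k * v k) := by
  intro N
  filter_upwards [hv (N + 1), hu.abs.eventually (gt_mem_nhds (lt_add_one |c|)),
    eventually_mul_pow_le ht0 ht (|c| + 1) (Nat.lt_add_one N)] with k h1 h2 h3
  rw [abs_mul]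
  exact (mul_le_mul h2.le h1 (abs_nonneg _) (by positivity)).trans h3

lemma IsFlat.tendsto (ht : Tendsto t U (𝓝 0)) {u : ℕ → ℝ} (hu : IsFlat U t u) :
    Tendsto u U (𝓝 0) := by
  rw [tendsto_zero_iff_abs_tendsto_zero]
  refine tendsto_of_tendsto_of_tendsto_of_le_of_le' tendsto_const_nhds ht
    (Eventually.of_forall fun k => abs_nonneg _) ?_
  simpa using hu 1

lemma exists_pow_lt_of_not_isFlat {u : ℕ → ℝ} (hu : ¬ IsFlat U t u) :
    ∃ M : ℕ, ∀ᶠ k in (U : Filter ℕ), t k ^ M < |u k| := by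
  simp only [IsFlat, not_forall] at hu
  obtain ⟨M, hM⟩ := hu
  exact ⟨M, by simpa using Ultrafilter.eventually_not.2 hM⟩

lemma IsFlat.or_of_mul {u v : ℕ → ℝ} (ht0 : ∀ᶠ k in (U : Filter ℕ), 0 < t k)
    (h : IsFlat U t (fun k => u k * v k)) : IsFlat U t u ∨ IsFlat U t v := by
  by_contra! hne
  obtain ⟨M, hM⟩ := exists_pow_lt_of_not_isFlat hne.1
  obtain ⟨K, hK⟩ := exists_pow_lt_of_not_isFlat hne.2
  obtain ⟨k, h0, h1, h2, h3⟩ := (ht0.and (hM.and (hK.and (h (M + K))))).exists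
  rw [abs_mul, pow_add] at h3
  exact absurd h3 (not_le.2 (mul_lt_mul'' h1 h2 (by positivity) (by positivity)))

lemma IsFlat.of_pow_mul {u v : ℕ → ℝ} (ht0 : ∀ᶠ k in (U : Filter ℕ), 0 < t k) {e : ℕ}
    (h : IsFlat U t u) (huv : ∀ᶠ k in (U : Filter ℕ), u k = t k ^ e * v k) : IsFlat U t v := by
  intro N
  filter_upwards [ht0, h (e + N), huv] with k h0 h1 h2
  rw [h2, abs_mul, abs_of_nonneg (by positivity : 0 ≤ t k ^ e), pow_add] at h1
  exact le_of_mul_le_mul_left h1 (by positivity)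

end Flat

section AnalyticGerms

/-- The ring of real functions that are analytic at the origin. -/
def analyticSubring (X : Type*) [NormedAddCommGroup X] [NormedSpace ℝ X] : Subring (X → ℝ) where
  carrier := {f | AnalyticAt ℝ f 0}
  mul_mem' := fun hf hg => AnalyticAt.mul hf hg
  one_mem' := analyticAt_const
  add_mem' := fun hf hg => AnalyticAt.add hf hg
  zero_mem' := analyticAt_const
  neg_mem' := fun hf => AnalyticAt.neg hf

variable {X : Type*} [NormedAddCommGroup X] [NormedSpace ℝ X]

/-- Evaluation of analytic functions at a point. -/
def analyticEval (x : X) : analyticSubring X →+* ℝ :=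
  (Pi.evalRingHom (fun _ : X => ℝ) x).comp (analyticSubring X).subtype

lemma analyticEval_apply (x : X) (f : analyticSubring X) : analyticEval x f = f.1 x := rfl

variable {U : Ultrafilter ℕ} {t : ℕ → ℝ}

/-- The ideal of functions analytic at the origin that are flat along the sequence `z`. -/
def flatIdeal (ht0 : ∀ᶠ k in (U : Filter ℕ), 0 < t k) (ht : Tendsto t U (𝓝 0)) {z : ℕ → X}
    (hz : Tendsto z U (𝓝 0)) : Ideal (analyticSubring X) where
  carrier := {f | IsFlat U t (fun k => f.1 (z k))}
  add_mem' := fun hf hg => IsFlat.add ht0 ht hf hg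
  zero_mem' := fun N => by
    filter_upwards [ht0] with k hk
    simp only [ZeroMemClass.coe_zero, Pi.zero_apply, abs_zero]
    positivity
  smul_mem' := fun f _ hg => IsFlat.mul_left_of_tendsto ht0 ht
    ((AnalyticAt.continuousAt f.2).tendsto.comp hz) hg

lemma flatIdeal_isPrime (ht0 : ∀ᶠ k in (U : Filter ℕ), 0 < t k) (ht : Tendsto t U (𝓝 0))
    {z : ℕ → X} (hz : Tendsto z U (𝓝 0)) : (flatIdeal ht0 ht hz).IsPrime where
  ne_top' := by
    rw [Ideal.ne_top_iff_one]
    intro h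
    have h1 : IsFlat U t (fun _ => 1) := h
    exact zero_ne_one (tendsto_nhds_unique (h1.tendsto ht) tendsto_const_nhds)
  mem_or_mem' := fun h => IsFlat.or_of_mul ht0 h

lemma natCast_notMem_flatIdeal (ht0 : ∀ᶠ k in (U : Filter ℕ), 0 < t k) (ht : Tendsto t U (𝓝 0))
    {z : ℕ → X} (hz : Tendsto z U (𝓝 0)) {n : ℕ} (hn : n ≠ 0) :
    (n : analyticSubring X) ∉ flatIdeal ht0 ht hz := by
  intro h
  have h1 : IsFlat U t (fun _ => (n : ℝ)) := h
  exact hn (by exact_mod_cast (tendsto_nhds_unique (h1.tendsto ht) tendsto_const_nhds).symm)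

lemma AnalyticAt.exists_lipschitz_ball {f : X → ℝ} (hf : AnalyticAt ℝ f 0) :
    ∃ L > 0, ∃ δ > 0, ∀ x y : X, ‖x‖ < δ → ‖y‖ < δ → |f x - f y| ≤ L * ‖x - y‖ := by
  obtain ⟨K, s, hs, hK⟩ := (hf.contDiffAt (n := 1)).exists_lipschitzOnWith
  obtain ⟨δ, hδ, hδs⟩ := Metric.mem_nhds_iff.1 hs
  refine ⟨K + 1, by positivity, δ, hδ, fun x y hx hy => ?_⟩
  have := hK.dist_le_mul x (hδs (by simpa using hx)) y (hδs (by simpa using hy))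
  rw [dist_eq_norm, dist_eq_norm, Real.norm_eq_abs] at this
  exact this.trans (by gcongr; linarith)

lemma AnalyticAt.exists_line_not_eventually_zero {f : X → ℝ} (hf : AnalyticAt ℝ f 0)
    (hne : ¬ ∀ᶠ x in 𝓝 (0 : X), f x = 0) : ∃ v : X, ¬ ∀ᶠ s in 𝓝 (0 : ℝ), f (s • v) = 0 := by
  obtain ⟨δ, hδ, hball⟩ := Metric.eventually_nhds_iff_ball.1 hf.eventually_analyticAt
  have : ∃ x ∈ Metric.ball (0 : X) δ, f x ≠ 0 := by
    by_contra! h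
    exact hne (Metric.eventually_nhds_iff_ball.2 ⟨δ, hδ, h⟩)
  obtain ⟨x, hx, hfx⟩ := this
  refine ⟨x, fun hev => hfx ?_⟩
  have han : AnalyticOnNhd ℝ (fun s : ℝ => f (s • x)) (Icc 0 1) := by
    intro s hs
    refine AnalyticAt.fun_comp (g := f) (hball _ ?_) (by fun_prop)
    rw [mem_ball_zero_iff] at hx ⊢
    rw [norm_smul, Real.norm_eq_abs, abs_of_nonneg hs.1]
    exact (mul_le_of_le_one_left (norm_nonneg x) hs.2).trans_lt hx
  have := han.eqOn_zero_of_preconnected_of_eventuallyEq_zero isPreconnected_Icc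
    (left_mem_Icc.2 zero_le_one) hev (right_mem_Icc.2 zero_le_one)
  simpa using this

end AnalyticGerms

lemma exists_root_of_deriv_near {φ φ' : ℝ → ℝ} (hφ : ∀ σ, HasDerivAt φ (φ' σ) σ) {s h D : ℝ}
    (hh : 0 < h) (hD : ∀ σ, |σ - s| ≤ h → |φ' σ - D| ≤ |D| / 2) (hs : |φ s| ≤ |D| / 2 * h) :
    ∃ σ, |σ - s| ≤ h ∧ φ σ = 0 := by
  wlog hDn : 0 ≤ D generalizing φ φ' D
  · obtain ⟨σ, h1, h2⟩ := this (φ := fun σ => -φ σ) (φ' := fun σ => -φ' σ) (D := -D)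
      (fun σ => (hφ σ).neg) (fun σ hσ => by
        rw [abs_neg, neg_sub_neg, abs_sub_comm]; exact hD σ hσ) (by simpa using hs)
      (by linarith)
    exact ⟨σ, h1, by linarith⟩
  rw [abs_of_nonneg hDn] at hs hD
  have hcont : ContinuousOn φ univ := fun σ _ => (hφ σ).continuousAt.continuousWithinAt
  obtain ⟨c₁, hc₁, e₁⟩ := exists_hasDerivAt_eq_slope φ φ' (by linarith : s < s + h)
    (hcont.mono (subset_univ _)) (fun σ _ => hφ σ)
  obtain ⟨c₂, hc₂, e₂⟩ := exists_hasDerivAt_eq_slope φ φ' (by linarith : s - h < s)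
    (hcont.mono (subset_univ _)) (fun σ _ => hφ σ)
  have d₁ := abs_le.1 (hD c₁ (abs_le.2 ⟨by linarith [hc₁.1], by linarith [hc₁.2]⟩))
  have d₂ := abs_le.1 (hD c₂ (abs_le.2 ⟨by linarith [hc₂.1], by linarith [hc₂.2]⟩))
  rw [add_sub_cancel_left, eq_div_iff hh.ne'] at e₁
  rw [sub_sub_cancel, eq_div_iff hh.ne'] at e₂
  have hs' := abs_le.1 hs
  have u₁ : D / 2 * h ≤ φ' c₁ * h := by gcongr; linarith
  have u₂ : D / 2 * h ≤ φ' c₂ * h := by gcongr; linarith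
  obtain ⟨σ, hσ, h0⟩ := intermediate_value_Icc (by linarith : s - h ≤ s + h)
    (hcont.mono (subset_univ _)) (⟨by linarith, by linarith⟩ : (0 : ℝ) ∈ Icc _ _)
  exact ⟨σ, abs_le.2 ⟨by linarith [hσ.1], by linarith [hσ.2]⟩, h0⟩

section HyperplaneFactor

variable {X : Type*} [NormedAddCommGroup X] [NormedSpace ℝ X] [FiniteDimensional ℝ X]

lemma AnalyticAt.exists_eq_mul_of_vanishing_on_ker {θ : X →L[ℝ] ℝ} {w : X} (hw : θ w = 1)
    {f : X → ℝ} (hf : AnalyticAt ℝ f 0) (h0 : ∀ᶠ x in 𝓝 (0 : X), θ x = 0 → f x = 0) :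
    ∃ f₁ : X → ℝ, AnalyticAt ℝ f₁ 0 ∧ ∀ᶠ x in 𝓝 (0 : X), f x = θ x * f₁ x := by
  have hθ : ¬ ∀ᶠ s in 𝓝 (0 : ℝ), θ (s • w) = 0 := by
    intro h
    have h1 : ∀ᶠ s in 𝓝[≠] (0 : ℝ), s = 0 := by
      filter_upwards [h.filter_mono nhdsWithin_le_nhds] with s hs
      simpa [hw] using hs
    obtain ⟨s, hs, hs'⟩ := (h1.and eventually_mem_nhdsWithin).exists
    exact hs' hs
  obtain ⟨d, hd⟩ := weierstrass_division θ w (θ.analyticAt 0) hθ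
  obtain ⟨q, r, hq, hr, hqr⟩ := hd f hf
  let π : X →L[ℝ] X := ContinuousLinearMap.id ℝ X - θ.smulRight w
  have hπ : ∀ x, π x = x - θ x • w := fun x => rfl
  have hθπ : ∀ x, θ (π x) = 0 := fun x => by rw [hπ, map_sub, map_smul, hw]; simp
  have hπ0 : Tendsto π (𝓝 0) (𝓝 0) := by simpa using π.continuous.tendsto 0
  have hrπ : ∀ j, AnalyticAt ℝ (fun x => r j (π x)) 0 := fun j =>
    AnalyticAt.fun_comp (g := r j) (by simpa using hr j) (π.analyticAt 0)
  rcases d with _ | d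
  · refine ⟨q, hq, ?_⟩
    filter_upwards [hqr] with x hx
    rw [hx]; simp [mul_comm]
  · refine ⟨fun x => q x + ∑ j ∈ Finset.range d, r (j + 1) (π x) * θ x ^ j, ?_, ?_⟩
    · refine hq.add (Finset.analyticAt_fun_sum _ fun j _ => ?_)
      exact (hrπ _).mul ((θ.analyticAt 0).pow j)
    · filter_upwards [hqr, hπ0.eventually h0, hπ0.eventually hqr] with x hx h1 h2
      rw [h1 (hθπ x), hθπ x] at h2
      have h3 : π x - (0 : ℝ) • w = π x := by simp
      rw [Finset.sum_range_succ', h3, Finset.sum_eq_zero (by intros; simp)] at h2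
      have h4 : r 0 (π x) = 0 := by simpa using h2.symm
      rw [Finset.sum_range_succ', ← hπ x, h4] at hx
      rw [hx, mul_add, Finset.mul_sum]
      have : ∀ j, r (j + 1) (π x) * θ x ^ (j + 1) = θ x * (r (j + 1) (π x) * θ x ^ j) :=
        fun j => by ring
      simp_rw [this]; ring

theorem AnalyticAt.exists_eq_pow_mul_not_vanishing_on_ker {θ : X →L[ℝ] ℝ} {w : X} (hw : θ w = 1)
    {f : X → ℝ} (hf : AnalyticAt ℝ f 0) (hne : ¬ ∀ᶠ x in 𝓝 (0 : X), f x = 0) :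
    ∃ (e : ℕ) (f' : X → ℝ), AnalyticAt ℝ f' 0 ∧ (∀ᶠ x in 𝓝 (0 : X), f x = θ x ^ e * f' x) ∧
      ∃ v, θ v = 0 ∧ ¬ ∀ᶠ s in 𝓝 (0 : ℝ), f' (s • v) = 0 := by
  obtain ⟨u, hu⟩ := hf.exists_line_not_eventually_zero hne
  have hline : Tendsto (fun s : ℝ => s • u) (𝓝 0) (𝓝 0) := by
    have : Continuous fun s : ℝ => s • u := by fun_prop
    simpa using this.tendsto 0
  have han : ∀ {h : X → ℝ}, AnalyticAt ℝ h 0 → AnalyticAt ℝ (fun s : ℝ => h (s • u)) 0 :=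
    fun {h} hh => AnalyticAt.fun_comp (g := h) (by simpa using hh) (by fun_prop)
  have hfin : analyticOrderAt (fun s : ℝ => f (s • u)) 0 ≠ ⊤ := by
    rwa [Ne, analyticOrderAt_eq_top]
  obtain ⟨m, hm⟩ := ENat.ne_top_iff_exists.1 hfin
  clear hne hu hfin
  induction m generalizing f with
  | zero =>
    refine ⟨0, f, hf, by simp, 0, map_zero _, fun h => ?_⟩
    have h1 := ((han hf).analyticOrderAt_eq_zero).1 hm.symm
    have h2 := h.self_of_nhds
    simp at h1 h2
    exact h1 h2
  | succ m ih =>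
    by_cases h0 : ∀ᶠ x in 𝓝 (0 : X), θ x = 0 → f x = 0
    · obtain ⟨f₁, hf₁, h₁⟩ := hf.exists_eq_mul_of_vanishing_on_ker hw h0
      have hord : analyticOrderAt (fun s : ℝ => f (s • u)) 0
          = analyticOrderAt (fun s : ℝ => s * θ u) 0
            + analyticOrderAt (fun s : ℝ => f₁ (s • u)) 0 := by
        rw [← analyticOrderAt_mul (by fun_prop) (han hf₁)]
        refine analyticOrderAt_congr ?_
        filter_upwards [hline.eventually h₁] with s hs
        rw [hs, map_smul, smul_eq_mul]; rfl
      have hθu : θ u ≠ 0 := by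
        intro h
        have : analyticOrderAt (fun s : ℝ => s * θ u) 0 = ⊤ := by
          rw [analyticOrderAt_eq_top]; simp [h]
        rw [this, top_add, ← hm] at hord
        exact ENat.natCast_ne_top _ hord
      have hone : analyticOrderAt (fun s : ℝ => s * θ u) 0 = 1 := by
        have : ((1 : ℕ) : ℕ∞) = 1 := rfl
        rw [← this, AnalyticAt.analyticOrderAt_eq_natCast (by fun_prop)]
        exact ⟨fun _ => θ u, analyticAt_const, hθu, by simp⟩
      rw [hone, ← hm, Nat.cast_add, Nat.cast_one, add_comm] at hord
      obtain ⟨e, f', hf', hfe, hv⟩ := ih hf₁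
        ((ENat.add_right_injective_of_ne_top ENat.one_ne_top) hord)
      refine ⟨e + 1, f', hf', ?_, hv⟩
      filter_upwards [h₁, hfe] with x hx hx'
      rw [hx, hx', pow_succ]; ring
    · let F := LinearMap.ker (θ : X →ₗ[ℝ] ℝ)
      have hfF : AnalyticAt ℝ (fun y : F => f y) 0 :=
        AnalyticAt.fun_comp (g := f) (f := fun y : F => (y : X)) (by simpa using hf)
          (F.subtypeL.analyticAt 0)
      have hneF : ¬ ∀ᶠ y : F in 𝓝 (0 : F), f (y : X) = 0 := by
        intro h
        apply h0
        rw [show (0 : F) = ⟨0, F.zero_mem⟩ from rfl, nhds_subtype_eq_comap, eventually_comap] at h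
        filter_upwards [h] with x hx hθx
        exact hx ⟨x, hθx⟩ rfl
      obtain ⟨v, hv⟩ := hfF.exists_line_not_eventually_zero hneF
      exact ⟨0, f, hf, by simp, v, v.2, hv⟩

end HyperplaneFactor

section Fibration

open Polynomial

variable {W : Type*} [NormedAddCommGroup W] [NormedSpace ℝ W]
  {F : Type*} [NormedAddCommGroup F] [NormedSpace ℝ F]
  {U : Ultrafilter ℕ} {t : ℕ → ℝ}

lemma IsFlat.congr' {u v : ℕ → ℝ} (hu : IsFlat U t u) (h : ∀ᶠ k in (U : Filter ℕ), u k = v k) :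
    IsFlat U t v := by
  intro N
  filter_upwards [hu N, h] with k h1 h2
  rwa [← h2]

/-- Precomposition with a continuous linear map, on functions analytic at the origin. -/
def analyticComp (π : W →L[ℝ] F) : analyticSubring F →+* analyticSubring W where
  toFun f := ⟨fun x => f.1 (π x),
    AnalyticAt.fun_comp (g := f.1) (by rw [map_zero]; exact f.2) (π.analyticAt 0)⟩
  map_one' := rfl
  map_mul' _ _ := rfl
  map_zero' := rfl
  map_add' _ _ := rfl

/-- The analytic function on `W` obtained from a polynomial with analytic coefficients on `F` by
substituting the projection `π` in the coefficients and `ℓ` for the variable. -/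
def liftPoly (π : W →L[ℝ] F) (ℓ : W →L[ℝ] ℝ) : (analyticSubring F)[X] →+* analyticSubring W :=
  eval₂RingHom (analyticComp π) ⟨ℓ, ℓ.analyticAt 0⟩

lemma liftPoly_apply (π : W →L[ℝ] F) (ℓ : W →L[ℝ] ℝ) (p : (analyticSubring F)[X]) (x : W) :
    (liftPoly π ℓ p).1 x = (p.map (analyticEval (π x))).eval (ℓ x) := by
  rw [← analyticEval_apply, liftPoly, coe_eval₂RingHom, hom_eval₂, eval_map]
  rfl

lemma liftPoly_C_apply (π : W →L[ℝ] F) (ℓ : W →L[ℝ] ℝ) (a : analyticSubring F) (x : W) :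
    (liftPoly π ℓ (C a)).1 x = a.1 (π x) := by
  rw [liftPoly_apply]; simp [analyticEval_apply]

lemma exists_lift_remainder (π : W →L[ℝ] F) (ℓ : W →L[ℝ] ℝ) (ι : F →L[ℝ] W) {r : ℕ → W → ℝ}
    (hr : ∀ j, AnalyticAt ℝ (r j) 0) (d : ℕ) :
    ∃ ρ : (analyticSubring F)[X], ρ.degree < d ∧
      ∀ x, (liftPoly π ℓ ρ).1 x = ∑ j ∈ Finset.range d, r j (ι (π x)) * ℓ x ^ j := by
  let a : ℕ → analyticSubring F := fun j => ⟨fun y => r j (ι y),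
    AnalyticAt.fun_comp (g := r j) (by simpa using hr j) (ι.analyticAt 0)⟩
  refine ⟨∑ j : Fin d, C (a j) * X ^ (j : ℕ), degree_sum_fin_lt _, fun x => ?_⟩
  rw [liftPoly_apply, Polynomial.map_sum, eval_finsetSum,
    Finset.sum_range (fun j => r j (ι (π x)) * ℓ x ^ j)]
  refine Finset.sum_congr rfl fun j _ => ?_
  simp [analyticEval_apply, a]

variable {π : W →L[ℝ] F} {ι : F →L[ℝ] W} {ℓ : W →L[ℝ] ℝ} {v : W}

lemma hasDerivAt_liftPoly (hπ : ∀ (y : F) (s : ℝ), π (ι y + s • v) = y)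
    (hℓ : ∀ (y : F) (s : ℝ), ℓ (ι y + s • v) = s) (p : (analyticSubring F)[X]) (y : F) (s : ℝ) :
    HasDerivAt (fun s => (liftPoly π ℓ p).1 (ι y + s • v))
      ((liftPoly π ℓ (derivative p)).1 (ι y + s • v)) s := by
  simp only [liftPoly_apply, hπ, hℓ, ← derivative_map]
  exact (p.map (analyticEval y)).hasDerivAt s

lemma not_eventually_liftPoly_eq_zero (hπ : ∀ (y : F) (s : ℝ), π (ι y + s • v) = y)
    (hℓ : ∀ (y : F) (s : ℝ), ℓ (ι y + s • v) = s) {w : (analyticSubring F)[X]} (hw : w.Monic) :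
    ¬ ∀ᶠ s in 𝓝 (0 : ℝ), (liftPoly π ℓ w).1 (s • v) = 0 := by
  intro h
  have hmonic : (w.map (analyticEval (0 : F))).Monic := hw.map _
  refine hmonic.ne_zero (eq_zero_of_infinite_isRoot _ (infinite_of_mem_nhds (0 : ℝ) ?_))
  filter_upwards [h] with s hs
  have h1 := hπ 0 s
  have h2 := hℓ 0 s
  rw [map_zero, zero_add] at h1 h2
  rwa [liftPoly_apply, h1, h2] at hs

theorem exists_polynomial_reduction [FiniteDimensional ℝ W]
    (hπι : ∀ x, ι (π x) = x - ℓ x • v) (hπ : ∀ (y : F) (s : ℝ), π (ι y + s • v) = y)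
    (hℓ : ∀ (y : F) (s : ℝ), ℓ (ι y + s • v) = s)
    (ht0 : ∀ᶠ k in (U : Filter ℕ), 0 < t k) (ht : Tendsto t U (𝓝 0)) {z : ℕ → W}
    (hz : Tendsto z U (𝓝 0)) {fs : Set (W → ℝ)} (hfin : fs.Finite)
    (hfs : ∀ f ∈ fs, AnalyticAt ℝ f 0 ∧ IsFlat U t (fun k => f (z k)))
    {g : W → ℝ} (hg : AnalyticAt ℝ g 0) (hgflat : IsFlat U t (fun k => g (z k)))
    (hgv : ¬ ∀ᶠ s in 𝓝 (0 : ℝ), g (s • v) = 0) :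
    ∃ p : (analyticSubring F)[X], IsFlat U t (fun k => (liftPoly π ℓ p).1 (z k)) ∧
      ¬ IsFlat U t (fun k => (liftPoly π ℓ (C p.leadingCoeff)).1 (z k)) ∧
      ¬ IsFlat U t (fun k => (liftPoly π ℓ (derivative p)).1 (z k)) ∧
      ∃ T : Set (F → ℝ), T.Finite ∧
        (∀ u ∈ T, AnalyticAt ℝ u 0 ∧ IsFlat U t (fun k => u (π (z k)))) ∧
        ∀ᶠ x in 𝓝 (0 : W), (liftPoly π ℓ p).1 x = 0 →
          (liftPoly π ℓ (C p.leadingCoeff)).1 x ≠ 0 → (∀ u ∈ T, u (π x) = 0) →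
          ∀ f ∈ fs, f x = 0 := by
  have hprime := flatIdeal_isPrime ht0 ht hz
  let P : Ideal (analyticSubring F)[X] := (flatIdeal ht0 ht hz).comap (liftPoly π ℓ)
  have hP : P.IsPrime := Ideal.comap_isPrime _ _
  have hmem : ∀ p, p ∈ P ↔ IsFlat U t (fun k => (liftPoly π ℓ p).1 (z k)) := fun p => Iff.rfl
  have hchar : ∀ n : ℕ, n ≠ 0 → (n : (analyticSubring F)[X]) ∉ P := by
    intro n hn h
    rw [Ideal.mem_comap, map_natCast] at h
    exact natCast_notMem_flatIdeal ht0 ht hz hn h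
  obtain ⟨d, hd⟩ := weierstrass_division ℓ v hg hgv
  obtain ⟨q₁, r₁, hq₁, hr₁, hqr₁⟩ := hd (fun x => ℓ x ^ d) ((ℓ.analyticAt 0).pow d)
  obtain ⟨ρ₁, hρ₁, hρ₁'⟩ := exists_lift_remainder π ℓ ι hr₁ d
  let w : (analyticSubring F)[X] := X ^ d - ρ₁
  have hwm : w.Monic := monic_X_pow_sub hρ₁
  have hwl : C w.leadingCoeff ∉ P := by
    rw [hwm.leadingCoeff, map_one]
    exact fun h => hP.ne_top ((Ideal.eq_top_iff_one _).2 h)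
  have hlX : ∀ x, (liftPoly π ℓ (X ^ d)).1 x = ℓ x ^ d := by
    intro x; rw [liftPoly_apply]; simp
  have hlw : ∀ x, (liftPoly π ℓ w).1 x = ℓ x ^ d - (liftPoly π ℓ ρ₁).1 x := by
    intro x
    rw [← hlX, map_sub]; rfl
  have hw : w ∈ P := by
    rw [hmem]
    refine IsFlat.congr' (IsFlat.mul_left_of_tendsto ht0 ht
      (hq₁.continuousAt.tendsto.comp hz) hgflat) ?_
    filter_upwards [hz.eventually hqr₁] with k hk
    rw [hlw, hk, hρ₁', hπι]
    simp
  obtain ⟨p, hp, hpl, hpd, hdiv⟩ := exists_mem_prime_pseudo_divisor hP hchar hw hwl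
  have hone : ∀ r ∈ P, ∃ T : Set (F → ℝ), T.Finite ∧
      (∀ u ∈ T, AnalyticAt ℝ u 0 ∧ IsFlat U t (fun k => u (π (z k)))) ∧
      ∀ x, (liftPoly π ℓ p).1 x = 0 → (liftPoly π ℓ (C p.leadingCoeff)).1 x ≠ 0 →
        (∀ u ∈ T, u (π x) = 0) → (liftPoly π ℓ r).1 x = 0 := by
    intro r hr
    obtain ⟨e, q, s, hqs, hs⟩ := hdiv r hr
    refine ⟨(fun i => (s.coeff i).1) '' Iic s.natDegree, (finite_Iic _).image _, ?_, ?_⟩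
    · rintro _ ⟨i, -, rfl⟩
      refine ⟨(s.coeff i).2, ?_⟩
      have := (hmem _).1 (hs i)
      simpa only [liftPoly_C_apply] using this
    · intro x hpx hlx hT
      have hsx : (liftPoly π ℓ s).1 x = 0 := by
        rw [liftPoly_apply, eval_map, eval₂_eq_sum_range]
        refine Finset.sum_eq_zero fun i hi => ?_
        have := hT _ ⟨i, by simpa [Nat.lt_succ_iff] using hi, rfl⟩
        rw [analyticEval_apply]
        exact mul_eq_zero_of_left this _
      have h1 := congrArg (fun f : analyticSubring W => f.1 x) (congrArg (liftPoly π ℓ) hqs)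
      simp only [map_mul, map_add, map_pow] at h1
      have h2 : (liftPoly π ℓ (C p.leadingCoeff)).1 x ^ e * (liftPoly π ℓ r).1 x
          = (liftPoly π ℓ q).1 x * (liftPoly π ℓ p).1 x + (liftPoly π ℓ s).1 x := h1
      rw [hpx, hsx, mul_zero, add_zero] at h2
      exact (mul_eq_zero.1 h2).resolve_left (pow_ne_zero _ hlx)
  obtain ⟨Tw, hTwf, hTw, hTw'⟩ := hone w hw
  obtain ⟨d', hd'⟩ := weierstrass_division ℓ v (liftPoly π ℓ w).2
    (not_eventually_liftPoly_eq_zero hπ hℓ hwm)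
  have heach : ∀ f ∈ fs, ∃ T : Set (F → ℝ), T.Finite ∧
      (∀ u ∈ T, AnalyticAt ℝ u 0 ∧ IsFlat U t (fun k => u (π (z k)))) ∧
      ∀ᶠ x in 𝓝 (0 : W), (liftPoly π ℓ p).1 x = 0 →
        (liftPoly π ℓ (C p.leadingCoeff)).1 x ≠ 0 →
        (∀ u ∈ Tw, u (π x) = 0) → (∀ u ∈ T, u (π x) = 0) → f x = 0 := by
    intro f hf
    obtain ⟨q, r, hq, hr, hqr⟩ := hd' f (hfs f hf).1
    obtain ⟨ρ, -, hρ⟩ := exists_lift_remainder π ℓ ι hr d'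
    have hρP : ρ ∈ P := by
      rw [hmem]
      refine IsFlat.congr' (IsFlat.add ht0 ht (hfs f hf).2 (IsFlat.mul_left_of_tendsto ht0 ht
        (hq.continuousAt.tendsto.comp hz).neg ((hmem w).1 hw))) ?_
      filter_upwards [hz.eventually hqr] with k hk
      rw [hk, hρ, hπι]
      simp
    obtain ⟨T, hTf, hT, hT'⟩ := hone ρ hρP
    refine ⟨T, hTf, hT, ?_⟩
    filter_upwards [hqr] with x hx h1 h2 h3 h4
    rw [← hπι, ← hρ] at hx
    rw [hx, hTw' x h1 h2 h3, hT' x h1 h2 h4]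
    simp
  choose! T hTf hT hT' using heach
  refine ⟨p, hp, hpl, hpd, Tw ∪ ⋃ f ∈ fs, T f, hTwf.union (hfin.biUnion hTf), ?_, ?_⟩
  · rintro u (hu | hu)
    · exact hTw u hu
    · obtain ⟨f, hf, huf⟩ := mem_iUnion₂.1 hu
      exact hT f hf u huf
  · filter_upwards [(hfin.eventually_all (l := 𝓝 (0 : W))).2 hT'] with x hx h1 h2 h3 f hf
    exact hx f hf h1 h2 (fun u hu => h3 u (Or.inl hu))
      (fun u hu => h3 u (Or.inr (mem_iUnion₂.2 ⟨f, hf, hu⟩)))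

end Fibration

section FlatZeros

variable {U : Ultrafilter ℕ} {t : ℕ → ℝ}

lemma exists_root_on_fiber {W F : Type*} [NormedAddCommGroup W] [NormedSpace ℝ W]
    [NormedAddCommGroup F] [NormedSpace ℝ F] {π : W →L[ℝ] F} {ι : F →L[ℝ] W} {ℓ : W →L[ℝ] ℝ}
    {v : W} (hπι : ∀ x, ι (π x) = x - ℓ x • v)
    (ht0 : ∀ᶠ k in (U : Filter ℕ), 0 < t k) (ht : Tendsto t U (𝓝 0)) {z : ℕ → W}
    (hz : Tendsto z U (𝓝 0)) {φ φ' c : W → ℝ} (hφ : AnalyticAt ℝ φ 0) (hφ' : AnalyticAt ℝ φ' 0)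
    (hc : AnalyticAt ℝ c 0)
    (hder : ∀ (y : F) (s : ℝ), HasDerivAt (fun s => φ (ι y + s • v)) (φ' (ι y + s • v)) s)
    (hφz : IsFlat U t (fun k => φ (z k))) (hφ'z : ¬ IsFlat U t (fun k => φ' (z k)))
    (hcz : ¬ IsFlat U t (fun k => c (z k))) (N : ℕ) :
    ∃ K : ℕ, ∀ᶠ k in (U : Filter ℕ), ∀ y : F, ‖y - π (z k)‖ ≤ t k ^ K →
      ∃ s : ℝ, ‖ι y + s • v - z k‖ ≤ t k ^ N ∧ φ (ι y + s • v) = 0 ∧ c (ι y + s • v) ≠ 0 := by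
  obtain ⟨L₀, hL₀, δ₀, hδ₀, lip₀⟩ := hφ.exists_lipschitz_ball
  obtain ⟨L₁, hL₁, δ₁, hδ₁, lip₁⟩ := hφ'.exists_lipschitz_ball
  obtain ⟨L₂, hL₂, δ₂, hδ₂, lip₂⟩ := hc.exists_lipschitz_ball
  obtain ⟨M₁, hM₁⟩ := exists_pow_lt_of_not_isFlat hφ'z
  obtain ⟨M₂, hM₂⟩ := exists_pow_lt_of_not_isFlat hcz
  obtain ⟨δ, hδ, hδ0, hδ1, hδ2⟩ : ∃ δ > 0, δ ≤ δ₀ ∧ δ ≤ δ₁ ∧ δ ≤ δ₂ :=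
    ⟨min δ₀ (min δ₁ δ₂), lt_min hδ₀ (lt_min hδ₁ hδ₂), min_le_left _ _,
      (min_le_right _ _).trans (min_le_left _ _), (min_le_right _ _).trans (min_le_right _ _)⟩
  let a := ‖ι‖ + ‖v‖
  let K := N + M₁ + M₂ + 2
  let K' := K + M₁ + 1
  refine ⟨K', ?_⟩
  filter_upwards [ht0, ht.eventually (gt_mem_nhds one_pos),
    ht.eventually (gt_mem_nhds (half_pos hδ)),
    hz.norm.eventually (gt_mem_nhds (by simpa using half_pos hδ : ‖(0 : W)‖ < δ / 2)),
    eventually_mul_pow_le ht0 ht a (by omega : N < K),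
    eventually_mul_pow_le ht0 ht a (by omega : 1 < K),
    eventually_mul_pow_le ht0 ht (2 * L₁ * a) (by omega : M₁ < K),
    eventually_mul_pow_le ht0 ht (L₂ * a) (by omega : M₂ < K),
    eventually_mul_pow_le ht0 ht (2 * (1 + L₀ * ‖ι‖)) (by omega : K + M₁ < K'),
    hφz K', hM₁, hM₂] with k h0 h1 h2 h3 e1 e2 e3 e4 e5 e6 e7 e8 y hy
  rw [pow_one] at e2
  have hzk : ‖z k‖ < δ := by linarith
  have hsub : ∀ s, ι y + s • v - z k = ι (y - π (z k)) + (s - ℓ (z k)) • v := by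
    intro s
    rw [map_sub, hπι, sub_smul]; abel
  have hKK : t k ^ K' ≤ t k ^ K := pow_le_pow_of_le_one h0.le h1.le (by omega)
  have hιy : ‖ι (y - π (z k))‖ ≤ ‖ι‖ * t k ^ K' :=
    (ι.le_opNorm _).trans (by gcongr)
  have hdist : ∀ s, |s - ℓ (z k)| ≤ t k ^ K → ‖ι y + s • v - z k‖ ≤ a * t k ^ K := by
    intro s hs
    rw [hsub]
    refine (norm_add_le _ _).trans ?_
    rw [norm_smul, Real.norm_eq_abs]
    have u1 : ‖ι‖ * t k ^ K' ≤ ‖ι‖ * t k ^ K := by gcongr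
    have u2 : |s - ℓ (z k)| * ‖v‖ ≤ t k ^ K * ‖v‖ := by gcongr
    have : a * t k ^ K = ‖ι‖ * t k ^ K + t k ^ K * ‖v‖ := by simp only [a]; ring
    linarith
  have hnear : ∀ s, |s - ℓ (z k)| ≤ t k ^ K → ‖ι y + s • v‖ < δ := by
    intro s hs
    have := norm_add_le (ι y + s • v - z k) (z k)
    rw [sub_add_cancel] at this
    linarith [hdist s hs]
  have hself : |ℓ (z k) - ℓ (z k)| ≤ t k ^ K := by rw [sub_self, abs_zero]; positivity
  obtain ⟨s, hs, hroot⟩ := exists_root_of_deriv_near (hder y) (s := ℓ (z k)) (h := t k ^ K)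
    (D := φ' (z k)) (by positivity) (fun s hs => by
      refine (lip₁ _ _ ((hnear s hs).trans_le hδ1) (hzk.trans_le hδ1)).trans ?_
      have : L₁ * ‖ι y + s • v - z k‖ ≤ L₁ * (a * t k ^ K) := by gcongr; exact hdist s hs
      linarith) (by
      have u1 := lip₀ _ _ ((hnear _ hself).trans_le hδ0) (hzk.trans_le hδ0)
      have u2 : ‖ι y + ℓ (z k) • v - z k‖ ≤ ‖ι‖ * t k ^ K' := by
        rw [hsub, sub_self, zero_smul, add_zero]; exact hιy
      have u3 : L₀ * ‖ι y + ℓ (z k) • v - z k‖ ≤ L₀ * (‖ι‖ * t k ^ K') := by gcongr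
      have u4 := abs_sub_abs_le_abs_sub (φ (ι y + ℓ (z k) • v)) (φ (z k))
      have u5 : t k ^ (K + M₁) ≤ |φ' (z k)| * t k ^ K := by
        rw [pow_add, mul_comm]; gcongr
      linarith)
  refine ⟨s, (hdist s hs).trans e1, hroot, fun hc0 => ?_⟩
  have u1 := lip₂ _ _ ((hnear s hs).trans_le hδ2) (hzk.trans_le hδ2)
  rw [hc0, zero_sub, abs_neg] at u1
  have u2 : L₂ * ‖ι y + s • v - z k‖ ≤ L₂ * (a * t k ^ K) := by gcongr; exact hdist s hs
  linarith

theorem exists_zero_near_of_isFlat (ht0 : ∀ᶠ k in (U : Filter ℕ), 0 < t k)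
    (ht : Tendsto t U (𝓝 0)) (n : ℕ) : ∀ (W : Type) [NormedAddCommGroup W] [NormedSpace ℝ W]
    [FiniteDimensional ℝ W], Module.finrank ℝ W = n → ∀ (θ : W →L[ℝ] ℝ) (z : ℕ → W),
    Tendsto z U (𝓝 0) → (∀ k, θ (z k) = t k) → ∀ fs : Set (W → ℝ), fs.Finite →
    (∀ f ∈ fs, AnalyticAt ℝ f 0 ∧ IsFlat U t (fun k => f (z k))) → ∀ N : ℕ, ∃ N' : ℕ,
    ∀ᶠ k in (U : Filter ℕ), ∀ τ : ℝ, |τ - t k| ≤ t k ^ N' →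
      ∃ y : W, θ y = τ ∧ ‖y - z k‖ ≤ t k ^ N ∧ ∀ f ∈ fs, f y = 0 := by
  induction n using Nat.strong_induction_on with
  | _ n ih =>
  intro W _ _ _ hn θ z hz hθ fs hfin hfs N
  obtain ⟨w, hw⟩ : ∃ w, θ w = 1 := by
    obtain ⟨k, hk⟩ := ht0.exists
    exact ⟨(t k)⁻¹ • z k, by rw [map_smul, hθ, smul_eq_mul, inv_mul_cancel₀ hk.ne']⟩
  have hnear : ∀ {Q : W → Prop}, (∀ᶠ x in 𝓝 (0 : W), Q x) →
      ∀ᶠ k in (U : Filter ℕ), ∀ y, ‖y - z k‖ ≤ t k ^ (N + 1) → Q y ∧ ‖y - z k‖ ≤ t k ^ N := by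
    intro Q hQ
    obtain ⟨δ, hδ, hball⟩ := Metric.eventually_nhds_iff_ball.1 hQ
    filter_upwards [ht0, ht.eventually (gt_mem_nhds one_pos),
      ht.eventually (gt_mem_nhds (half_pos hδ)),
      hz.norm.eventually (gt_mem_nhds (by simpa using half_pos hδ : ‖(0 : W)‖ < δ / 2))]
      with k h0 h1 h2 h3 y hy
    refine ⟨hball y ?_, hy.trans (pow_le_pow_of_le_one h0.le h1.le (Nat.le_succ N))⟩
    have u1 := norm_add_le (y - z k) (z k)
    have u2 : t k ^ (N + 1) ≤ t k ^ 1 := pow_le_pow_of_le_one h0.le h1.le (by omega)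
    rw [sub_add_cancel] at u1
    rw [pow_one] at u2
    rw [mem_ball_zero_iff]
    linarith
  by_cases hall : ∀ f ∈ fs, ∀ᶠ x in 𝓝 (0 : W), f x = 0
  · refine ⟨N + 2, ?_⟩
    filter_upwards [hnear ((hfin.eventually_all (l := 𝓝 (0 : W))).2 hall), ht0,
      eventually_mul_pow_le ht0 ht ‖w‖ (Nat.lt_add_one (N + 1))] with k h1 h2 h3 τ hτ
    have h4 : ‖z k + (τ - t k) • w - z k‖ ≤ t k ^ (N + 1) := by
      rw [add_sub_cancel_left, norm_smul, Real.norm_eq_abs, mul_comm]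
      exact (by gcongr : ‖w‖ * |τ - t k| ≤ ‖w‖ * t k ^ (N + 2)).trans h3
    refine ⟨z k + (τ - t k) • w, ?_, (h1 _ h4).2, (h1 _ h4).1⟩
    rw [map_add, map_smul, hw, hθ]; simp
  push Not at hall
  obtain ⟨f, hf, hfne⟩ := hall
  obtain ⟨e, g, hg, hfg, v, hθv, hgv⟩ := (hfs f hf).1.exists_eq_pow_mul_not_vanishing_on_ker hw
    (not_eventually.2 hfne)
  have hgflat : IsFlat U t (fun k => g (z k)) := by
    refine IsFlat.of_pow_mul ht0 (hfs f hf).2 (e := e) ?_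
    filter_upwards [hz.eventually hfg] with k hk
    rw [hk, hθ]
  have hv : v ≠ 0 := by
    rintro rfl
    apply hgv
    have h1 : g 0 = 0 := tendsto_nhds_unique (hg.continuousAt.tendsto.comp hz) (hgflat.tendsto ht)
    simp [h1]
  obtain ⟨ℓ, hℓv⟩ := SeparatingDual.exists_eq_one (R := ℝ) hv
  let F := LinearMap.ker (ℓ : W →ₗ[ℝ] ℝ)
  let ι : F →L[ℝ] W := F.subtypeL
  let π : W →L[ℝ] F := (ContinuousLinearMap.id ℝ W - ℓ.smulRight v).codRestrict F (fun x => by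
    change ℓ (x - ℓ x • v) = 0
    rw [map_sub, map_smul, hℓv]; simp)
  have hπι : ∀ x, ι (π x) = x - ℓ x • v := fun x => rfl
  have hℓ : ∀ (y : F) (s : ℝ), ℓ (ι y + s • v) = s := by
    intro y s
    have : ℓ (ι y) = 0 := y.2
    rw [map_add, this, map_smul, hℓv]; simp
  have hπ : ∀ (y : F) (s : ℝ), π (ι y + s • v) = y := by
    intro y s
    apply Subtype.ext
    change ι y + s • v - ℓ (ι y + s • v) • v = ι y
    rw [hℓ]; simp
  have hrank : Module.finrank ℝ F < n := by
    rw [← hn]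
    refine Submodule.finrank_lt fun htop => ?_
    have : v ∈ F := htop ▸ Submodule.mem_top
    exact one_ne_zero (hℓv.symm.trans this)
  obtain ⟨p, hp, hpl, hpd, T, hTfin, hT, hzero⟩ :=
    exists_polynomial_reduction hπι hπ hℓ ht0 ht hz hfin hfs hg hgflat hgv
  obtain ⟨K, hK⟩ := exists_root_on_fiber hπι ht0 ht hz (liftPoly π ℓ p).2
    (liftPoly π ℓ (Polynomial.derivative p)).2 (liftPoly π ℓ (Polynomial.C p.leadingCoeff)).2
    (hasDerivAt_liftPoly hπ hℓ p) hp hpd hpl (N + 1)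
  have hπz : Tendsto (fun k => π (z k)) U (𝓝 0) := by
    have := (π.continuous.tendsto 0).comp hz
    rwa [map_zero] at this
  obtain ⟨N', hN'⟩ := ih _ hrank F rfl (θ.comp ι) (fun k => π (z k)) hπz (fun k => by
    rw [ContinuousLinearMap.comp_apply, hπι, map_sub, map_smul, hθv, hθ]; simp) T hTfin hT K
  refine ⟨N', ?_⟩
  filter_upwards [hN', hK, hnear hzero] with k h1 h2 h3 τ hτ
  obtain ⟨y, hyτ, hyz, hyT⟩ := h1 τ hτ
  obtain ⟨s, hs, hroot, hc⟩ := h2 y hyz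
  refine ⟨ι y + s • v, ?_, (h3 _ hs).2, (h3 _ hs).1 hroot hc ?_⟩
  · rw [map_add, map_smul, hθv, smul_zero, add_zero]; exact hyτ
  · intro u hu
    rw [hπ]; exact hyT u hu

end FlatZeros

section SmallSpheres

variable {E : Type} [NormedAddCommGroup E] [InnerProductSpace ℝ E] [FiniteDimensional ℝ E]

theorem exists_nonneg_on_nearby_sphere {U : Ultrafilter ℕ} {x : ℕ → E}
    (hx0 : ∀ᶠ k in (U : Filter ℕ), x k ≠ 0) (hx : Tendsto x U (𝓝 0)) {I : Type*} [Finite I]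
    {g : I → E → ℝ} (hg : ∀ i, AnalyticAt ℝ (g i) 0)
    (hgx : ∀ i, ∀ M : ℕ, ∀ᶠ k in (U : Filter ℕ), -‖x k‖ ^ M ≤ g i (x k)) (N : ℕ) :
    ∃ N' : ℕ, ∀ᶠ k in (U : Filter ℕ), ∀ τ : ℝ, |τ - ‖x k‖| ≤ ‖x k‖ ^ N' →
      ∃ y, ‖y‖ = τ ∧ ‖y - x k‖ ≤ ‖x k‖ ^ N ∧ ∀ i, 0 ≤ g i y := by
  have ht0 : ∀ᶠ k in (U : Filter ℕ), 0 < ‖x k‖ := by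
    filter_upwards [hx0] with k hk using norm_pos_iff.2 hk
  have ht : Tendsto (fun k => ‖x k‖) U (𝓝 0) := by simpa using hx.norm
  have hpos : ∀ i, ¬ IsFlat U (fun k => ‖x k‖) (fun k => g i (x k)) →
      ∃ K : ℕ, ∀ᶠ k in (U : Filter ℕ), ∀ y, ‖y - x k‖ ≤ ‖x k‖ ^ K → 0 ≤ g i y := by
    intro i hi
    obtain ⟨M, hM⟩ := exists_pow_lt_of_not_isFlat hi
    obtain ⟨L, hL, δ, hδ, lip⟩ := (hg i).exists_lipschitz_ball
    refine ⟨M + 1, ?_⟩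
    filter_upwards [ht0, ht.eventually (gt_mem_nhds one_pos),
      ht.eventually (gt_mem_nhds (half_pos hδ)),
      eventually_mul_pow_le ht0 ht L (Nat.lt_add_one M), hM, hgx i M]
      with k h0 h1 h2 h3 h4 h5 y hy
    have u1 := norm_add_le (y - x k) (x k)
    have u2 : ‖x k‖ ^ (M + 1) ≤ ‖x k‖ ^ 1 := pow_le_pow_of_le_one h0.le h1.le (by omega)
    rw [sub_add_cancel] at u1
    rw [pow_one] at u2
    have u3 := (abs_le.1 (lip y (x k) (by linarith) (by linarith))).1
    have u4 : L * ‖y - x k‖ ≤ L * ‖x k‖ ^ (M + 1) := by gcongr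
    rcases lt_abs.1 h4 with h | h <;> linarith
  choose! K hK using hpos
  obtain ⟨K₀, hK₀⟩ : ∃ K₀, ∀ i, K i ≤ K₀ := by
    obtain ⟨K₀, h⟩ := (finite_range K).bddAbove
    exact ⟨K₀, fun i => h ⟨i, rfl⟩⟩
  let sq : ℝ × E → ℝ := fun p => ‖p.2‖ ^ 2 - p.1 ^ 2
  have hsq : AnalyticAt ℝ sq 0 := by
    have h1 : AnalyticAt ℝ (fun y : E => ‖y‖ ^ 2) (0 : ℝ × E).2 :=
      (contDiff_norm_sq ℝ (n := ⊤)).contDiffAt.analyticAt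
    exact (AnalyticAt.fun_comp (g := fun y : E => ‖y‖ ^ 2) h1 analyticAt_snd).sub
      (analyticAt_fst.pow 2)
  let lift : I → ℝ × E → ℝ := fun i p => g i p.2
  have hlift : ∀ i, AnalyticAt ℝ (lift i) 0 := fun i =>
    AnalyticAt.fun_comp (g := g i) (f := fun p : ℝ × E => p.2) (by simpa using hg i) analyticAt_snd
  let fs : Set (ℝ × E → ℝ) :=
    insert sq (lift '' {i | IsFlat U (fun k => ‖x k‖) (fun k => g i (x k))})
  have hfs : ∀ f ∈ fs, AnalyticAt ℝ f 0 ∧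
      IsFlat U (fun k => ‖x k‖) (fun k => f (‖x k‖, x k)) := by
    rintro f (rfl | ⟨i, hi, rfl⟩)
    · refine ⟨hsq, fun M => ?_⟩
      filter_upwards with k
      simp [sq]
    · exact ⟨hlift i, hi⟩
  have hz : Tendsto (fun k => (‖x k‖, x k)) U (𝓝 (0 : ℝ × E)) := ht.prodMk_nhds hx
  obtain ⟨N', hN'⟩ := exists_zero_near_of_isFlat ht0 ht _ (ℝ × E) rfl
    (ContinuousLinearMap.fst ℝ ℝ E) _ hz (fun _ => rfl) fs ((toFinite _).insert _) hfs (N + K₀)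
  refine ⟨N' + 2, ?_⟩
  have hKall : ∀ᶠ k in (U : Filter ℕ), ∀ i,
      ¬ IsFlat U (fun k => ‖x k‖) (fun k => g i (x k)) →
      ∀ y, ‖y - x k‖ ≤ ‖x k‖ ^ K i → 0 ≤ g i y := by
    refine eventually_all.2 fun i => ?_
    by_cases hi : IsFlat U (fun k => ‖x k‖) (fun k => g i (x k))
    · exact Eventually.of_forall fun k h => absurd hi h
    · filter_upwards [hK i hi] with k hk _ using hk
  filter_upwards [hN', hKall, ht0, ht.eventually (gt_mem_nhds one_pos)] with k h1 h2 h0 hlt τ hτ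
  have hmono : ∀ {a b : ℕ}, a ≤ b → ‖x k‖ ^ b ≤ ‖x k‖ ^ a := fun hab =>
    pow_le_pow_of_le_one h0.le hlt.le hab
  obtain ⟨⟨τ', y⟩, hτ', hy, hfy⟩ := h1 τ (hτ.trans (hmono (by omega)))
  obtain rfl : τ' = τ := hτ'
  have hτ0 : 0 ≤ τ' := by
    have u1 : ‖x k‖ ^ (N' + 2) ≤ ‖x k‖ ^ 1 := hmono (by omega)
    rw [pow_one] at u1
    linarith [(abs_le.1 hτ).1]
  have hyx : ‖y - x k‖ ≤ ‖x k‖ ^ (N + K₀) := (norm_snd_le ((τ', y) - (‖x k‖, x k))).trans hy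
  refine ⟨y, ?_, hyx.trans (hmono (by omega)), fun i => ?_⟩
  · have h3 := hfy sq (mem_insert _ _)
    exact (pow_left_inj₀ (norm_nonneg y) hτ0 two_ne_zero).1 (sub_eq_zero.1 h3)
  · by_cases hi : IsFlat U (fun k => ‖x k‖) (fun k => g i (x k))
    · exact (hfy (lift i) (mem_insert_of_mem _ ⟨i, hi, rfl⟩)).ge
    · exact h2 i hi y (hyx.trans (hmono ((hK₀ i).trans (by omega))))

theorem exists_uniform_nonneg_on_sphere {I : Type*} [Finite I] {g : I → E → ℝ}
    (hg : ∀ i, AnalyticAt ℝ (g i) 0) (c : ℕ) :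
    ∃ N : ℕ, ∀ᶠ x in 𝓝 (0 : E), x ≠ 0 → (∀ i, -‖x‖ ^ N ≤ g i x) →
      ∃ y, ‖y‖ = ‖x‖ ∧ ‖y - x‖ ≤ ‖x‖ ^ c ∧ ∀ i, 0 ≤ g i y := by
  by_contra! hcon
  have hseq : ∀ N : ℕ, ∃ x : E, ‖x‖ < 1 / ((N : ℝ) + 1) ∧ x ≠ 0 ∧ (∀ i, -‖x‖ ^ N ≤ g i x) ∧
      ∀ y, ‖y‖ = ‖x‖ → ‖y - x‖ ≤ ‖x‖ ^ c → ∃ i, g i y < 0 := by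
    intro N
    have h1 : ∀ᶠ x in 𝓝 (0 : E), ‖x‖ < 1 / ((N : ℝ) + 1) :=
      continuous_norm.tendsto' (0 : E) 0 norm_zero |>.eventually
        (gt_mem_nhds Nat.one_div_pos_of_nat)
    obtain ⟨x, h2, h3⟩ := ((hcon N).and_eventually h1).exists
    exact ⟨x, h3, h2⟩
  choose x hxN hx0 hgx hno using hseq
  let U : Ultrafilter ℕ := hyperfilter ℕ
  have hU : (U : Filter ℕ) ≤ atTop := Nat.hyperfilter_le_atTop
  have hx : Tendsto x U (𝓝 0) := by
    refine Tendsto.mono_left ?_ hU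
    exact squeeze_zero_norm (fun N => (hxN N).le) tendsto_one_div_add_atTop_nhds_zero_nat
  have hlow : ∀ i, ∀ M : ℕ, ∀ᶠ k in (U : Filter ℕ), -‖x k‖ ^ M ≤ g i (x k) := by
    intro i M
    filter_upwards [hU (eventually_ge_atTop M)] with k hk
    refine le_trans (neg_le_neg ?_) (hgx k i)
    refine pow_le_pow_of_le_one (norm_nonneg _) ((hxN k).le.trans ?_) hk
    rw [div_le_one (by positivity)]
    linarith [(Nat.cast_nonneg k : (0 : ℝ) ≤ k)]
  obtain ⟨N', hN'⟩ := exists_nonneg_on_nearby_sphere (Eventually.of_forall hx0) hx hg hlow c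
  obtain ⟨k, hk⟩ := hN'.exists
  obtain ⟨y, hy1, hy2, hy3⟩ := hk ‖x k‖ (by rw [sub_self, abs_zero]; positivity)
  obtain ⟨i, hi⟩ := hno k y hy1 hy2
  exact absurd (hy3 i) (not_le.2 hi)

theorem eventually_nonempty_inter_sphere {R : ℝ} (hR : 0 < R) {J : Type*} [Finite J]
    {I : J → Type*} [∀ j, Finite (I j)] {g : (j : J) → I j → E → ℝ}
    (hg : ∀ j i, AnalyticAt ℝ (g j i) 0) {A : Set E}
    (hA : A = ⋃ j, {x ∈ Metric.ball (0 : E) R | ∀ i, 0 ≤ g j i x}) (hclosed : IsClosed A)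
    (hacc : (0 : E) ∈ closure (A \ {0})) :
    ∃ ε > 0, ∀ r : ℝ, 0 < r → r < ε → (A ∩ Metric.sphere (0 : E) r).Nonempty := by
  by_contra! hcon
  have hseq : ∀ k : ℕ, ∃ b : ℝ, 0 < b ∧ b < R ∧ b < 1 / ((k : ℝ) + 1) ∧
      A ∩ Metric.sphere (0 : E) b = ∅ := by
    intro k
    obtain ⟨b, hb0, hb, hbA⟩ := hcon (min R (1 / ((k : ℝ) + 1)))
      (lt_min hR Nat.one_div_pos_of_nat)
    exact ⟨b, hb0, hb.trans_le (min_le_left _ _), hb.trans_le (min_le_right _ _), hbA⟩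
  choose b hb0 hbR hbk hbA using hseq
  have hmax : ∀ k, ∃ x ∈ A, x ≠ 0 ∧ ‖x‖ < b k ∧ ∀ y ∈ A, ‖y‖ ≤ b k → ‖y‖ ≤ ‖x‖ := by
    intro k
    obtain ⟨a, ⟨haA, ha0⟩, hab⟩ := Metric.mem_closure_iff.1 hacc (b k) (hb0 k)
    rw [dist_zero_left] at hab
    have hcomp : IsCompact (A ∩ Metric.closedBall 0 (b k)) :=
      (isCompact_closedBall (0 : E) (b k)).inter_left hclosed
    obtain ⟨x, ⟨hxA, hxb⟩, hx⟩ := hcomp.exists_isMaxOn ⟨a, haA, by simpa using hab.le⟩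
      continuous_norm.continuousOn
    rw [mem_closedBall_zero_iff] at hxb
    have hax : ‖a‖ ≤ ‖x‖ := hx ⟨haA, by simpa using hab.le⟩
    have ha : 0 < ‖a‖ := norm_pos_iff.2 ha0
    refine ⟨x, hxA, norm_pos_iff.1 (ha.trans_le hax), lt_of_le_of_ne hxb fun h => ?_, ?_⟩
    · exact (hbA k).le ⟨hxA, by simpa using h⟩
    · exact fun y hy hyb => hx ⟨hy, by simpa using hyb⟩
  choose x hxA hx0 hxb hxmax using hmax
  let U : Ultrafilter ℕ := hyperfilter ℕ
  have hU : (U : Filter ℕ) ≤ atTop := Nat.hyperfilter_le_atTop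
  have hx : Tendsto x U (𝓝 0) := by
    refine Tendsto.mono_left ?_ hU
    exact squeeze_zero_norm (fun k => ((hxb k).trans (hbk k)).le)
      tendsto_one_div_add_atTop_nhds_zero_nat
  obtain ⟨j, hj⟩ : ∃ j, ∀ᶠ k in (U : Filter ℕ), ∀ i, 0 ≤ g j i (x k) := by
    by_contra! hno
    have h1 : ∀ᶠ k in (U : Filter ℕ), ∀ j, ¬ ∀ i, 0 ≤ g j i (x k) :=
      eventually_all.2 fun j => (hno j).mono fun k hk h => by
        obtain ⟨i, hi⟩ := hk
        exact absurd (h i) (not_le.2 hi)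
    obtain ⟨k, hk⟩ := h1.exists
    have h2 := hxA k
    rw [hA] at h2
    obtain ⟨j, -, hj⟩ := mem_iUnion.1 h2
    exact hk j hj
  obtain ⟨N', hN'⟩ := exists_nonneg_on_nearby_sphere (Eventually.of_forall hx0) hx (hg j)
    (fun i M => by
      filter_upwards [hj] with k hk
      exact (neg_nonpos.2 (by positivity)).trans (hk i)) 0
  obtain ⟨k, hk⟩ := hN'.exists
  have hxk : 0 < ‖x k‖ := norm_pos_iff.2 (hx0 k)
  have hlt : ‖x k‖ < min (b k) (‖x k‖ + ‖x k‖ ^ N') :=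
    lt_min (hxb k) (lt_add_of_pos_right _ (by positivity))
  obtain ⟨y, hy, -, hgy⟩ := hk (min (b k) (‖x k‖ + ‖x k‖ ^ N')) (by
    rw [abs_of_nonneg (sub_nonneg.2 hlt.le), sub_le_iff_le_add']
    exact min_le_right _ _)
  have hyb : ‖y‖ ≤ b k := hy ▸ min_le_left _ _
  have hyA : y ∈ A := by
    rw [hA]
    exact mem_iUnion.2 ⟨j, by simpa using hyb.trans_lt (hbR k), hgy⟩
  exact absurd (hxmax k y hyA hyb) (not_le.2 (hy ▸ hlt))

end SmallSpheres

section PolynomialApproximation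

variable {n : ℕ}

theorem ContinuousMultilinearMap.exists_eval_eq_apply_const {k : ℕ}
    (f : ContinuousMultilinearMap ℝ (fun _ : Fin k => EuclideanSpace ℝ (Fin n)) ℝ) :
    ∃ q : MvPolynomial (Fin n) ℝ, ∀ x : EuclideanSpace ℝ (Fin n),
      MvPolynomial.eval ((WithLp.equiv 2 (Fin n → ℝ)) x) q = f fun _ => x := by
  let b := (EuclideanSpace.basisFun (Fin n) ℝ).toBasis
  refine ⟨∑ i : Fin k → Fin n, (∏ l, MvPolynomial.X (i l)) * MvPolynomial.C (f fun l => b (i l)),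
    fun x => ?_⟩
  rw [f.apply_const_eq_sum_basis b x]
  simp [b]

theorem AnalyticAt.exists_mvPolynomial_isBigO {g : EuclideanSpace ℝ (Fin n) → ℝ}
    (hg : AnalyticAt ℝ g 0) (N : ℕ) :
    ∃ T : MvPolynomial (Fin n) ℝ,
      (fun x => g x - MvPolynomial.eval ((WithLp.equiv 2 (Fin n → ℝ)) x) T) =O[𝓝 0]
        fun x => ‖x‖ ^ N := by
  obtain ⟨p, hp⟩ := hg
  choose T hT using fun k => (p k).exists_eval_eq_apply_const
  refine ⟨∑ k ∈ Finset.range N, T k, ?_⟩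
  simp only [map_sum, hT]
  simpa [FormalMultilinearSeries.partialSum] using hp.isBigO_sub_partialSum_pow N

theorem AnalyticAt.exists_mvPolynomial_sign {g : EuclideanSpace ℝ (Fin n) → ℝ}
    (hg : AnalyticAt ℝ g 0) {N : ℕ} (hN : 1 ≤ N) :
    ∃ q : MvPolynomial (Fin n) ℝ, ∀ᶠ x in 𝓝 (0 : EuclideanSpace ℝ (Fin n)),
      (0 ≤ g x → 0 ≤ MvPolynomial.eval ((WithLp.equiv 2 (Fin n → ℝ)) x) q) ∧
      (0 ≤ MvPolynomial.eval ((WithLp.equiv 2 (Fin n → ℝ)) x) q → -‖x‖ ^ N ≤ g x) := by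
  obtain ⟨T, hT⟩ := hg.exists_mvPolynomial_isBigO (2 * N + 1)
  obtain ⟨C, hC0, hC⟩ := hT.exists_pos
  refine ⟨T + (∑ i, MvPolynomial.X i ^ 2) ^ N, ?_⟩
  have hsmall : ∀ ε > (0 : ℝ), ∀ᶠ x in 𝓝 (0 : EuclideanSpace ℝ (Fin n)), ‖x‖ < ε := by
    intro ε hε
    filter_upwards [Metric.ball_mem_nhds (0 : EuclideanSpace ℝ (Fin n)) hε] with x hx
    simpa using hx
  filter_upwards [hC.bound, hsmall (1 / 2) (by norm_num), hsmall (1 / (2 * C)) (by positivity)]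
    with x hx hx2 hxC
  have heval : MvPolynomial.eval ((WithLp.equiv 2 (Fin n → ℝ)) x)
      (T + (∑ i, MvPolynomial.X i ^ 2) ^ N) =
      MvPolynomial.eval ((WithLp.equiv 2 (Fin n → ℝ)) x) T + ‖x‖ ^ (2 * N) := by
    rw [map_add, pow_mul, EuclideanSpace.norm_sq_eq]
    simp
  rw [heval]
  have h0 := norm_nonneg x
  have hP : (0 : ℝ) ≤ ‖x‖ ^ N := by positivity
  have hclose : |g x - MvPolynomial.eval ((WithLp.equiv 2 (Fin n → ℝ)) x) T| ≤
      ‖x‖ ^ (2 * N) / 2 := by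
    rw [Real.norm_eq_abs, Real.norm_of_nonneg (by positivity), pow_succ] at hx
    have h1 : C * ‖x‖ ≤ 1 / 2 := by
      rw [lt_div_iff₀ (by positivity)] at hxC
      linarith
    have h2 : (0 : ℝ) ≤ ‖x‖ ^ (2 * N) := by positivity
    nlinarith [mul_le_mul_of_nonneg_left h1 h2]
  have hpow : ‖x‖ ^ (2 * N) ≤ ‖x‖ ^ N * (1 / 2) := by
    rw [two_mul, pow_add]
    refine mul_le_mul_of_nonneg_left ?_ hP
    exact (pow_le_of_le_one h0 (by linarith) (by lia)).trans hx2.le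
  obtain ⟨h1, h2⟩ := abs_le.1 hclose
  have h3 : (0 : ℝ) ≤ ‖x‖ ^ (2 * N) := by positivity
  exact ⟨fun h => by linarith, fun h => by linarith⟩

end PolynomialApproximation

end

/-- **Theorem 3.8 (Ferrarotti–Fortuna–Wilson).**
Let `A ⊆ Ω` be a closed set presented by finitely many real-analytic inequalities on an
open ball `Ω` centered at the origin of `ℝ^n`, with `0 ∈ A` a non-isolated point of `A`.
Then for every `s ≥ 1` there is a closed semialgebraic set `S` (a finite union of sets
defined by finitely many polynomial inequalities `q ≥ 0`) containing `0`, whose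
intersections with small spheres are nonempty, such that
`D(A ∩ S_r, S ∩ S_r) / r^s → 0` as `r → 0⁺`. -/
theorem semialgebraic_approximation_of_semianalytic
    {n : ℕ} (R : ℝ) (hR : 0 < R)
    (N : ℕ) (m : Fin N → ℕ)
    (g : (j : Fin N) → Fin (m j) → EuclideanSpace ℝ (Fin n) → ℝ)
    (hg : ∀ j i, AnalyticOnNhd ℝ (g j i) (Metric.ball (0 : EuclideanSpace ℝ (Fin n)) R))
    (A : Set (EuclideanSpace ℝ (Fin n)))
    (hApres : A = ⋃ j : Fin N,
      {x ∈ Metric.ball (0 : EuclideanSpace ℝ (Fin n)) R | ∀ i : Fin (m j), 0 ≤ g j i x})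
    (hAclosed : IsClosed A)
    (h0A : (0 : EuclideanSpace ℝ (Fin n)) ∈ A)
    (h0acc : (0 : EuclideanSpace ℝ (Fin n)) ∈ closure (A \ {0}))
    (s : ℝ) (hs : 1 ≤ s) :
    ∃ (M : ℕ) (k : Fin M → ℕ) (q : (j : Fin M) → Fin (k j) → MvPolynomial (Fin n) ℝ)
      (S : Set (EuclideanSpace ℝ (Fin n))),
      S = (⋃ j : Fin M, {x : EuclideanSpace ℝ (Fin n) |
            ∀ i : Fin (k j), 0 ≤ MvPolynomial.eval ((WithLp.equiv 2 (Fin n → ℝ)) x) (q j i)}) ∧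
      (0 : EuclideanSpace ℝ (Fin n)) ∈ S ∧
      (∃ ε > 0, ∀ r : ℝ, 0 < r → r < ε →
        (A ∩ Metric.sphere (0 : EuclideanSpace ℝ (Fin n)) r).Nonempty ∧
        (S ∩ Metric.sphere (0 : EuclideanSpace ℝ (Fin n)) r).Nonempty) ∧
      Tendsto
        (fun r : ℝ => Metric.hausdorffDist
            (A ∩ Metric.sphere (0 : EuclideanSpace ℝ (Fin n)) r)
            (S ∩ Metric.sphere (0 : EuclideanSpace ℝ (Fin n)) r) / r ^ s)
        (nhdsWithin 0 (Set.Ioi 0)) (nhds 0) := by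
  have hgA : ∀ j i, AnalyticAt ℝ (g j i) 0 := fun j i => hg j i 0 (mem_ball_self hR)
  set c := ⌈s⌉₊ + 1 with hc
  choose K hK using fun j => exists_uniform_nonneg_on_sphere (hgA j) c
  set L := Finset.univ.sup K + 1 with hL
  choose q hq using fun j i => (hgA j i).exists_mvPolynomial_sign (N := L) (Nat.le_add_left 1 _)
  set S : Set (EuclideanSpace ℝ (Fin n)) := ⋃ j, {x | ∀ i,
    0 ≤ MvPolynomial.eval ((WithLp.equiv 2 (Fin n → ℝ)) x) (q j i)} with hS
  have hsign := eventually_all.2 fun j => eventually_all.2 (hq j)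
  obtain ⟨δ, hδ, hball⟩ := Metric.eventually_nhds_iff_ball.1 (hsign.and (eventually_all.2 hK))
  obtain ⟨ε, hε, hne⟩ := eventually_nonempty_inter_sphere hR hgA hApres hAclosed h0acc
  have hAS : ∀ x ∈ A, ‖x‖ < δ → x ∈ S := by
    intro x hxA hx
    rw [hApres] at hxA
    obtain ⟨j, -, hj⟩ := mem_iUnion.1 hxA
    exact mem_iUnion.2 ⟨j, fun i => ((hball x (by simpa using hx)).1 j i).1 (hj i)⟩
  have hSA : ∀ x ∈ S, x ≠ 0 → ‖x‖ < min δ (min R 1) →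
      ∃ y ∈ A, ‖y‖ = ‖x‖ ∧ ‖y - x‖ ≤ ‖x‖ ^ c := by
    intro x hxS hx0 hx
    obtain ⟨hxδ, hx'⟩ := lt_min_iff.1 hx
    obtain ⟨hxR, hx1⟩ := lt_min_iff.1 hx'
    obtain ⟨j, hj⟩ := mem_iUnion.1 hxS
    obtain ⟨h1, h2⟩ := hball x (by simpa using hxδ)
    obtain ⟨y, hy, hyx, hgy⟩ := h2 j hx0 fun i => by
      refine le_trans (neg_le_neg ?_) ((h1 j i).2 (hj i))
      exact pow_le_pow_of_le_one (norm_nonneg x) hx1.le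
        ((Finset.le_sup (Finset.mem_univ j)).trans (Nat.le_succ _))
    refine ⟨y, ?_, hy, hyx⟩
    rw [hApres]
    exact mem_iUnion.2 ⟨j, by simpa [hy] using hxR, hgy⟩
  have hdist : ∀ r : ℝ, 0 < r → r < min δ (min R 1) →
      hausdorffDist (A ∩ sphere 0 r) (S ∩ sphere 0 r) ≤ r ^ c := by
    intro r hr0 hr
    refine hausdorffDist_le_of_mem_dist (by positivity) ?_ ?_
    · rintro x ⟨hxA, hx⟩
      rw [mem_sphere_zero_iff_norm] at hx
      refine ⟨x, ⟨hAS x hxA (hx ▸ hr.trans_le (min_le_left _ _)), by simpa using hx⟩, ?_⟩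
      rw [dist_self]
      positivity
    · rintro x ⟨hxS, hx⟩
      rw [mem_sphere_zero_iff_norm] at hx
      obtain ⟨y, hyA, hy, hyx⟩ :=
        hSA x hxS (norm_pos_iff.1 (hx.symm ▸ hr0)) (hx.symm ▸ hr)
      refine ⟨y, ⟨hyA, by simpa [hx] using hy⟩, ?_⟩
      rw [dist_comm, dist_eq_norm]
      exact hx ▸ hyx
  refine ⟨N, m, q, S, hS, hAS 0 h0A (by simpa using hδ), ⟨min ε δ, lt_min hε hδ, ?_⟩, ?_⟩
  · intro r hr0 hr
    have hA := hne r hr0 (hr.trans_le (min_le_left _ _))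
    refine ⟨hA, hA.mono ?_⟩
    rintro x ⟨hxA, hx⟩
    refine ⟨hAS x hxA ?_, hx⟩
    rw [mem_sphere_zero_iff_norm.1 hx]
    exact hr.trans_le (min_le_right _ _)
  · refine squeeze_zero' (g := fun r : ℝ => r) ?_ ?_ (tendsto_id.mono_left nhdsWithin_le_nhds)
    · filter_upwards [self_mem_nhdsWithin] with r hr
      exact div_nonneg hausdorffDist_nonneg (Real.rpow_nonneg (le_of_lt hr) s)
    · have hpos : 0 < min δ (min R 1) := lt_min hδ (lt_min hR one_pos)
      filter_upwards [Ioo_mem_nhdsGT hpos] with r hr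
      have hr1 : r ≤ 1 := (hr.2.trans_le ((min_le_right _ _).trans (min_le_right _ _))).le
      rw [div_le_iff₀ (Real.rpow_pos_of_pos hr.1 s)]
      refine (hdist r hr.1 hr.2).trans ?_
      rw [hc, pow_succ, mul_comm, ← Real.rpow_natCast]
      exact mul_le_mul_of_nonneg_left
        (Real.rpow_le_rpow_of_exponent_ge hr.1 hr1 (Nat.le_ceil s)) hr.1.le
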